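/- Let ℓ ≥ 1 and λ > 0 be fixed, and define the Zygmund norm using the Ditzian–Totik modulus of order r = 2ℓ (with λ ≤ 2ℓ). Let α, β > −1 with α + β + 1 ≥ 0, and let k : [0,1]×[0,1] → ℝ be continuous with sup_{s∈[0,1]} ‖k_s‖_{Z_λ} < ∞. Then there exists a constant C > 0, independent of m, f and s, such that for every f ∈ Z_λ, every m ≥ 1 and every s ∈ [0,1], the pointwise bound |(Vf)(s) − (V_m^{(ℓ)}f)(s)| ≤ C · s^{α+β+1} · ‖k_s‖_{Z_λ} · ‖f‖_{Z_λ} · ( m^{−λ/2} + m^{−ℓ} ) holds. -/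

import Mathlib

open Set MeasureTheory

/-- Bernstein basis polynomial `p_{m,k}(x) = C(m,k) x^k (1-x)^(m-k)`. -/
noncomputable def bern (m k : ℕ) (x : ℝ) : ℝ :=
  (m.choose k : ℝ) * x ^ k * (1 - x) ^ (m - k)

/-- The Bernstein operator `B_m`. -/
noncomputable def Bop (m : ℕ) (f : ℝ → ℝ) : ℝ → ℝ :=
  fun x => ∑ k ∈ Finset.range (m + 1), bern m k x * f ((k : ℝ) / (m : ℝ))

/-- The generalized Bernstein operator `B_{m,ℓ} = I - (I - B_m)^ℓ`. -/
noncomputable def GBop (m l : ℕ) (f : ℝ → ℝ) : ℝ → ℝ :=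
  fun x => f x - ((fun g => g - Bop m g)^[l] f) x

/-- Fundamental generalized Bernstein polynomials
`p^{(ℓ)}_{m,j} = ∑_{i=1}^ℓ C(ℓ,i) (-1)^{i-1} B_m^{i-1}(p_{m,j})`. -/
noncomputable def gbBasis (m l j : ℕ) : ℝ → ℝ :=
  fun x => ∑ i ∈ Finset.Icc 1 l,
    (l.choose i : ℝ) * (-1 : ℝ) ^ (i - 1) * ((Bop m)^[i - 1] (bern m j) x)

/-- Sup norm on `[0,1]`. -/
noncomputable def supNorm (f : ℝ → ℝ) : ℝ := ⨆ x : Set.Icc (0 : ℝ) 1, |f (x : ℝ)|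

/-- `φ(x) = √(x(1-x))`. -/
noncomputable def phiDT (x : ℝ) : ℝ := Real.sqrt (x * (1 - x))

/-- Symmetric difference `Δ^r_{hφ} f(x)`. -/
noncomputable def dtDiff (r : ℕ) (h : ℝ) (f : ℝ → ℝ) (x : ℝ) : ℝ :=
  ∑ k ∈ Finset.range (r + 1),
    (-1 : ℝ) ^ k * (r.choose k : ℝ) * f (x + ((r : ℝ) - 2 * k) * (h / 2) * phiDT x)

/-- `x ∈ [0,1]` and all the nodes of `Δ^r_{hφ} f(x)` lie in `[0,1]`. -/
def dtAdmissible (r : ℕ) (h : ℝ) (x : ℝ) : Prop :=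
  x ∈ Set.Icc (0 : ℝ) 1 ∧
    ∀ k ≤ r, x + ((r : ℝ) - 2 * k) * (h / 2) * phiDT x ∈ Set.Icc (0 : ℝ) 1

/-- Ditzian–Totik modulus of smoothness `ω^r_φ(f,t)`. -/
noncomputable def omegaDT (r : ℕ) (f : ℝ → ℝ) (t : ℝ) : ℝ :=
  sSup {y | ∃ h x, 0 < h ∧ h ≤ t ∧ dtAdmissible r h x ∧ y = |dtDiff r h f x|}

/-- The set of quotients `ω^r_φ(f,t)/t^λ`, `t > 0`. -/
def zygSet (lam : ℝ) (r : ℕ) (f : ℝ → ℝ) : Set ℝ :=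
  {y | ∃ t : ℝ, 0 < t ∧ y = omegaDT r f t / t ^ lam}

/-- Membership in the Hölder–Zygmund space `Z_λ` (modulus of order `r`). -/
def memZ (lam : ℝ) (r : ℕ) (f : ℝ → ℝ) : Prop :=
  ContinuousOn f (Set.Icc 0 1) ∧ BddAbove (zygSet lam r f)

/-- The Zygmund norm `‖f‖_{Z_λ} = ‖f‖ + sup_{t>0} ω^r_φ(f,t)/t^λ`. -/
noncomputable def Znorm (lam : ℝ) (r : ℕ) (f : ℝ → ℝ) : ℝ :=
  supNorm f + sSup (zygSet lam r f)

/-- Volterra integral operator `(Vf)(s) = ∫_0^s k(t,s) f(t) (s-t)^α t^β dt`. -/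
noncomputable def Vop (alp bet : ℝ) (k : ℝ → ℝ → ℝ) (f : ℝ → ℝ) (s : ℝ) : ℝ :=
  ∫ t in (0 : ℝ)..s, k t s * f t * (s - t) ^ alp * t ^ bet

/-- Quadrature coefficients `Q^{(ℓ)}_j(s) = ∫_0^s p^{(ℓ)}_{m,j}(t)(s-t)^α t^β dt`. -/
noncomputable def Qcoef (alp bet : ℝ) (m l j : ℕ) (s : ℝ) : ℝ :=
  ∫ t in (0 : ℝ)..s, gbBasis m l j t * (s - t) ^ alp * t ^ bet

/-- Discrete Volterra operator `(V_m^{(ℓ)}f)(s) = ∑_j Q^{(ℓ)}_j(s) k(j/m,s) f(j/m)`. -/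
noncomputable def Vmop (alp bet : ℝ) (k : ℝ → ℝ → ℝ) (m l : ℕ) (f : ℝ → ℝ) (s : ℝ) : ℝ :=
  ∑ j ∈ Finset.range (m + 1),
    Qcoef alp bet m l j s * k ((j : ℝ) / (m : ℝ)) s * f ((j : ℝ) / (m : ℝ))

section

open Polynomial

/-- The weight `max (x (1 - x)) (1 / m)`. -/
noncomputable def wt (m : ℕ) (x : ℝ) : ℝ := max (x * (1 - x)) (1 / (m : ℝ))

lemma le_wt (m : ℕ) (x : ℝ) : x * (1 - x) ≤ wt m x := le_max_left _ _

lemma inv_le_wt (m : ℕ) (x : ℝ) : 1 / (m : ℝ) ≤ wt m x := le_max_right _ _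

lemma wt_pos {m : ℕ} (hm : 1 ≤ m) (x : ℝ) : 0 < wt m x :=
  lt_of_lt_of_le (by positivity) (inv_le_wt m x)

lemma inv_natCast_le_one {m : ℕ} (hm : 1 ≤ m) : 1 / (m : ℝ) ≤ 1 := by
  rw [div_le_one (by positivity)]; exact_mod_cast hm

lemma wt_le_one {m : ℕ} (hm : 1 ≤ m) (x : ℝ) : wt m x ≤ 1 :=
  max_le (by nlinarith [sq_nonneg (x - 1 / 2)]) (inv_natCast_le_one hm)

lemma bern_nonneg (m k : ℕ) {x : ℝ} (hx : x ∈ Icc (0 : ℝ) 1) : 0 ≤ bern m k x := by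
  have h0 := hx.1
  have h1 : 0 ≤ 1 - x := by linarith [hx.2]
  unfold bern
  positivity

lemma sum_bern (m : ℕ) (x : ℝ) : ∑ k ∈ Finset.range (m + 1), bern m k x = 1 := by
  have h := add_pow x (1 - x) m
  rw [add_sub_cancel, one_pow] at h
  rw [h]
  exact Finset.sum_congr rfl fun k _ => by unfold bern; ring

lemma div_mem_Icc_of_mem_range {m k : ℕ} (hk : k ∈ Finset.range (m + 1)) :
    (k : ℝ) / (m : ℝ) ∈ Icc (0 : ℝ) 1 := by
  have hk' : (k : ℝ) ≤ m := by exact_mod_cast Nat.lt_succ_iff.mp (Finset.mem_range.mp hk)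
  exact ⟨by positivity, div_le_one_of_le₀ hk' (by positivity)⟩

lemma abs_Bop_le {m : ℕ} {g E : ℝ → ℝ} (h : ∀ u ∈ Icc (0 : ℝ) 1, |g u| ≤ E u)
    {x : ℝ} (hx : x ∈ Icc (0 : ℝ) 1) : |Bop m g x| ≤ Bop m E x := by
  refine (Finset.abs_sum_le_sum_abs _ _).trans (Finset.sum_le_sum fun k hk => ?_)
  rw [abs_mul, abs_of_nonneg (bern_nonneg m k hx)]
  exact mul_le_mul_of_nonneg_left (h _ (div_mem_Icc_of_mem_range hk)) (bern_nonneg m k hx)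

lemma Bop_mono {m : ℕ} {g E : ℝ → ℝ} (h : ∀ u ∈ Icc (0 : ℝ) 1, g u ≤ E u)
    {x : ℝ} (hx : x ∈ Icc (0 : ℝ) 1) : Bop m g x ≤ Bop m E x :=
  Finset.sum_le_sum fun k hk =>
    mul_le_mul_of_nonneg_left (h _ (div_mem_Icc_of_mem_range hk)) (bern_nonneg m k hx)

lemma Bop_const (m : ℕ) (c x : ℝ) : Bop m (fun _ => c) x = c := by
  unfold Bop
  rw [← Finset.sum_mul, sum_bern, one_mul]

/-- The Bernstein operator as a linear map. -/
noncomputable def BopLin (m : ℕ) : (ℝ → ℝ) →ₗ[ℝ] (ℝ → ℝ) where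
  toFun := Bop m
  map_add' f g := by
    funext x
    simp only [Bop, Pi.add_apply, mul_add, Finset.sum_add_distrib]
  map_smul' c f := by
    funext x
    simp only [Bop, Pi.smul_apply, smul_eq_mul, Finset.mul_sum, RingHom.id_apply]
    exact Finset.sum_congr rfl fun k _ => by ring

/-- The error operator `(I - B_m)^l` as a linear map. -/
noncomputable def errLin (m l : ℕ) : (ℝ → ℝ) →ₗ[ℝ] (ℝ → ℝ) := (1 - BopLin m) ^ l

lemma errLin_succ (m l : ℕ) (f : ℝ → ℝ) :
    errLin m (l + 1) f = errLin m l f - Bop m (errLin m l f) := by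
  unfold errLin
  rw [pow_succ']
  rfl

lemma errLin_zero (m : ℕ) (f : ℝ → ℝ) : errLin m 0 f = f := by
  simp [errLin]

lemma abs_errLin_le {m : ℕ} {E : ℝ → ℝ} {c : ℝ}
    (hE : ∀ u ∈ Icc (0 : ℝ) 1, Bop m E u ≤ c * E u) {g : ℝ → ℝ}
    (hg : ∀ u ∈ Icc (0 : ℝ) 1, |g u| ≤ E u) (l : ℕ) :
    ∀ u ∈ Icc (0 : ℝ) 1, |errLin m l g u| ≤ (1 + c) ^ l * E u := by
  have hc : ∀ u ∈ Icc (0 : ℝ) 1, 0 ≤ (1 + c) * E u := fun u hu => by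
    have h1 : 0 ≤ E u := (abs_nonneg _).trans (hg u hu)
    have h2 : 0 ≤ Bop m E u := (abs_nonneg _).trans (abs_Bop_le hg hu)
    linarith [hE u hu]
  by_cases hc0 : 0 ≤ 1 + c
  · induction l with
    | zero => simpa [errLin_zero] using hg
    | succ l ih =>
      intro u hu
      rw [errLin_succ, Pi.sub_apply]
      have h1 := ih u hu
      have h2 : |Bop m (errLin m l g) u| ≤ (1 + c) ^ l * (c * E u) := by
        refine (abs_Bop_le ih hu).trans ?_
        have h3 : Bop m (fun v => (1 + c) ^ l * E v) u = (1 + c) ^ l * Bop m E u :=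
          congrFun ((BopLin m).map_smul ((1 + c) ^ l) E) u
        rw [h3]
        exact mul_le_mul_of_nonneg_left (hE u hu) (by positivity)
      refine (abs_sub _ _).trans ?_
      rw [pow_succ]
      linarith
  · have hz : ∀ u ∈ Icc (0 : ℝ) 1, E u = 0 := fun u hu => by
      have h1 : 0 ≤ E u := (abs_nonneg _).trans (hg u hu)
      nlinarith [hc u hu]
    intro u hu
    rw [hz u hu, mul_zero]
    induction l generalizing u with
    | zero => simpa [errLin_zero, hz u hu] using hg u hu
    | succ l ih =>
      rw [errLin_succ, Pi.sub_apply]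
      have h2 := abs_Bop_le (E := fun _ => 0) (m := m) (fun v hv => ih v hv) hu
      rw [Bop_const] at h2
      linarith [abs_sub (errLin m l g u) (Bop m (errLin m l g) u), ih u hu]

lemma hasDerivAt_bern (m k : ℕ) (hk : k ≤ m) (x : ℝ) :
    ∃ d, HasDerivAt (bern m k) d x ∧ x * (1 - x) * d = (k - m * x) * bern m k x := by
  have h1 := ((hasDerivAt_pow k x).const_mul (m.choose k : ℝ)).mul
    (((hasDerivAt_id x).const_sub 1).pow (m - k))
  refine ⟨_, h1, ?_⟩
  obtain ⟨n, rfl⟩ := Nat.exists_eq_add_of_le hk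
  simp only [bern, add_tsub_cancel_left]
  rcases k with _ | k <;> rcases n with _ | n <;> push_cast <;> simp <;> ring

/-- Central moments of the Bernstein operator, as polynomials in the base point. -/
noncomputable def cmom (m : ℕ) : ℕ → ℝ[X]
  | 0 => 1
  | 1 => 0
  | (k + 2) => C (1 / (m : ℝ)) *
      ((derivative (cmom m (k + 1)) + C ((k : ℝ) + 1) * cmom m k) * (X - X ^ 2))

lemma cmom_eval {m : ℕ} (hm : 1 ≤ m) (k : ℕ) : ∀ x : ℝ, (cmom m k).eval x =
    ∑ i ∈ Finset.range (m + 1), bern m i x * ((i : ℝ) / m - x) ^ k := by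
  have hm0 : (m : ℝ) ≠ 0 := by positivity
  have key : ∀ (k : ℕ) (x : ℝ), ∃ D, HasDerivAt (fun x => ∑ i ∈ Finset.range (m + 1),
        bern m i x * ((i : ℝ) / m - x) ^ (k + 1)) D x ∧
      (∑ i ∈ Finset.range (m + 1), bern m i x * ((i : ℝ) / m - x) ^ (k + 2)) =
        1 / m * ((D + (k + 1) * ∑ i ∈ Finset.range (m + 1),
          bern m i x * ((i : ℝ) / m - x) ^ k) * (x - x ^ 2)) := by
    intro k x
    have h : ∀ i ∈ Finset.range (m + 1), ∃ d, HasDerivAt (bern m i) d x ∧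
        x * (1 - x) * d = (i - m * x) * bern m i x := fun i hi =>
      hasDerivAt_bern m i (Nat.lt_succ_iff.mp (Finset.mem_range.mp hi)) x
    choose! d hd hd' using h
    refine ⟨_, HasDerivAt.fun_sum fun i hi => (hd i hi).mul
      (((hasDerivAt_id x).const_sub ((i : ℝ) / m)).pow (k + 1)), ?_⟩
    rw [Finset.mul_sum, ← Finset.sum_add_distrib, Finset.sum_mul, Finset.mul_sum]
    refine Finset.sum_congr rfl fun i hi => ?_
    have h2 := hd' i hi
    have h3 : (i : ℝ) - m * x = m * (i / m - x) := by field_simp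
    rw [h3] at h2
    simp only [id, Nat.add_sub_cancel]
    push_cast
    have h4 : bern m i x * ((i : ℝ) / m - x) = 1 / m * (x * (1 - x) * d i) := by
      rw [h2]; field_simp
    linear_combination ((i : ℝ) / m - x) ^ (k + 1) * h4
  have base0 : ∀ x : ℝ, (cmom m 0).eval x =
    ∑ i ∈ Finset.range (m + 1), bern m i x * ((i : ℝ) / m - x) ^ 0 := fun x => by
    simp [cmom, sum_bern]
  induction k using Nat.strong_induction_on with
  | _ k ih =>
    match k with
    | 0 => exact base0
    | 1 =>
      intro x
      simp only [cmom, eval_zero, pow_one]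
      have h : ∀ i ∈ Finset.range (m + 1), ∃ d, HasDerivAt (bern m i) d x ∧
          x * (1 - x) * d = (i - m * x) * bern m i x := fun i hi =>
        hasDerivAt_bern m i (Nat.lt_succ_iff.mp (Finset.mem_range.mp hi)) x
      choose! d hd hd' using h
      have h1 : HasDerivAt (fun x => ∑ i ∈ Finset.range (m + 1), bern m i x)
          (∑ i ∈ Finset.range (m + 1), d i) x := HasDerivAt.fun_sum hd
      have h2 : HasDerivAt (fun x => ∑ i ∈ Finset.range (m + 1), bern m i x) 0 x := by
        simp_rw [sum_bern]; exact hasDerivAt_const x 1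
      have h3 := h1.unique h2
      have h4 : ∑ i ∈ Finset.range (m + 1), (bern m i x * ((i : ℝ) / m - x)) =
          (1 / m * (x * (1 - x))) * ∑ i ∈ Finset.range (m + 1), d i := by
        rw [Finset.mul_sum]
        refine Finset.sum_congr rfl fun i hi => ?_
        rw [mul_assoc, hd' i hi]; field_simp
      rw [h4, h3, mul_zero]
    | (k + 2) =>
      intro x
      obtain ⟨D, hD, hD'⟩ := key k x
      have h1 := (cmom m (k + 1)).hasDerivAt x
      rw [show (fun x => eval x (cmom m (k + 1))) = _ from funext (ih (k + 1) (by omega))] at h1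
      rw [hD', ← h1.unique hD, ← ih k (by omega)]
      simp [cmom]

lemma pow_trade {u w : ℝ} (hu : 0 ≤ u) (huw : u ≤ w) (hw : w ≤ 1) {E E' f f' : ℕ} (a : ℕ)
    (h : E ≤ E') (h' : E + f ≤ E' + f') : u ^ E' * w ^ (f' - a) ≤ u ^ E * w ^ (f - a) := by
  have hw0 : 0 ≤ w := hu.trans huw
  obtain ⟨n, rfl⟩ := Nat.exists_eq_add_of_le h
  calc u ^ (E + n) * w ^ (f' - a) = u ^ E * (u ^ n * w ^ (f' - a)) := by ring
    _ ≤ u ^ E * (w ^ n * w ^ (f' - a)) := by gcongr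
    _ = u ^ E * w ^ (n + (f' - a)) := by ring
    _ ≤ u ^ E * w ^ (f - a) :=
      mul_le_mul_of_nonneg_left (pow_le_pow_of_le_one hw0 hw (by omega)) (by positivity)

lemma abs_eval_iterate_derivative_X_sub_sq_le (m : ℕ) {x : ℝ}
    (hx : x ∈ Icc (0 : ℝ) 1) (k : ℕ) :
    |(derivative^[k] (X - X ^ 2 : ℝ[X])).eval x| ≤ 2 * wt m x ^ (1 - k) := by
  have h0 := hx.1
  have h1 := hx.2
  have hw := le_wt m x
  match k with
  | 0 =>
    simp only [Function.iterate_zero, id, eval_sub, eval_X, eval_pow, tsub_zero, pow_one]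
    rw [abs_of_nonneg (by nlinarith)]
    nlinarith
  | 1 =>
    simp only [Function.iterate_one, derivative_sub, derivative_X, derivative_X_pow]
    simp
    rw [abs_le]
    constructor <;> linarith
  | 2 =>
    simp [Function.iterate_succ]
    norm_num
  | (k + 3) =>
    have h : derivative^[3] (X - X ^ 2 : ℝ[X]) = 0 := by simp [Function.iterate_succ]
    rw [Function.iterate_add_apply, h, iterate_derivative_zero]
    simp

lemma abs_eval_iterate_derivative_mul_le {m : ℕ} (hm : 1 ≤ m) {x : ℝ} {p q : ℝ[X]} {A B : ℝ}
    {c d : ℕ → ℝ} {e f : ℕ} (hA : 0 ≤ A) (hB : 0 ≤ B) (hc : ∀ a, 0 ≤ c a) (hd : ∀ a, 0 ≤ d a)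
    (hp : ∀ a, |(derivative^[a] p).eval x| ≤ c a * (A * wt m x ^ (e - a)))
    (hq : ∀ a, |(derivative^[a] q).eval x| ≤ d a * (B * wt m x ^ (f - a))) (a : ℕ) :
    |(derivative^[a] (p * q)).eval x| ≤
      (∑ k ∈ Finset.range (a + 1), (a.choose k : ℝ) * (c (a - k) * d k)) *
        (A * B * wt m x ^ (e + f - a)) := by
  have hw0 := (wt_pos hm x).le
  rw [iterate_derivative_mul, eval_finsetSum, Finset.sum_mul]
  refine (Finset.abs_sum_le_sum_abs _ _).trans (Finset.sum_le_sum fun k hk => ?_)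
  have hk' : k ≤ a := Nat.lt_succ_iff.mp (Finset.mem_range.mp hk)
  rw [nsmul_eq_mul, eval_mul, eval_mul, eval_natCast, abs_mul, abs_mul, Nat.abs_cast, mul_assoc]
  refine mul_le_mul_of_nonneg_left ?_ (by positivity)
  calc _ ≤ (c (a - k) * (A * wt m x ^ (e - (a - k)))) * (d k * (B * wt m x ^ (f - k))) := by
        have := hc (a - k)
        exact mul_le_mul (hp _) (hq _) (abs_nonneg _) (by positivity)
    _ = (c (a - k) * d k) * (A * B * wt m x ^ ((e - (a - k)) + (f - k))) := by rw [pow_add]; ring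
    _ ≤ _ := by
        have h1 := hc (a - k)
        have h2 := hd k
        refine mul_le_mul_of_nonneg_left (mul_le_mul_of_nonneg_left ?_ (by positivity))
          (by positivity)
        exact pow_le_pow_of_le_one hw0 (wt_le_one hm x) (by omega)

lemma exists_abs_eval_iterate_derivative_cmom_le (k : ℕ) : ∃ c : ℕ → ℝ, (∀ a, 0 ≤ c a) ∧
    ∀ m : ℕ, 1 ≤ m → ∀ x ∈ Icc (0 : ℝ) 1, ∀ a, |(derivative^[a] (cmom m k)).eval x| ≤
      c a * ((1 / (m : ℝ)) ^ (k - k / 2) * wt m x ^ (k / 2 - a)) := by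
  induction k using Nat.strong_induction_on with
  | _ k ih =>
    match k with
    | 0 =>
      refine ⟨fun _ => 1, fun _ => zero_le_one, fun m hm x hx a => ?_⟩
      rcases a with _ | a
      · simp [cmom]
      · simp [cmom]
    | 1 =>
      refine ⟨fun _ => 0, fun _ => le_rfl, fun m hm x hx a => ?_⟩
      simp [cmom]
    | (k + 2) =>
      obtain ⟨c₁, hc₁, h₁⟩ := ih (k + 1) (by omega)
      obtain ⟨c₀, hc₀, h₀⟩ := ih k (by omega)
      refine ⟨fun a => (∑ j ∈ Finset.range (a + 1), (a.choose j : ℝ) * (c₁ (a - j + 1) * 2)) +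
          (∑ j ∈ Finset.range (a + 1), (a.choose j : ℝ) * ((((k : ℝ) + 1) * c₀ (a - j)) * 2)),
        fun a => ?_, fun m hm x hx a => ?_⟩
      · refine add_nonneg (Finset.sum_nonneg fun j _ => ?_) (Finset.sum_nonneg fun j _ => ?_)
        · have := hc₁ (a - j + 1); positivity
        · have := hc₀ (a - j); positivity
      · have hu : 0 ≤ 1 / (m : ℝ) := by positivity
        have hq : ∀ a, |(derivative^[a] (X - X ^ 2 : ℝ[X])).eval x| ≤
            2 * (1 * wt m x ^ (1 - a)) := fun a => by
          rw [one_mul]; exact abs_eval_iterate_derivative_X_sub_sq_le m hx a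
        have e₁ := abs_eval_iterate_derivative_mul_le (p := derivative (cmom m (k + 1)))
          (c := fun a => c₁ (a + 1)) (d := fun _ => 2) (e := (k + 1) / 2 - 1) hm
          (A := (1 / (m : ℝ)) ^ (k + 1 - (k + 1) / 2))
          (by positivity) zero_le_one (fun a => hc₁ (a + 1)) (fun _ => zero_le_two)
          (fun a => by
            have := h₁ m hm x hx (a + 1)
            rwa [Function.iterate_succ_apply, show (k + 1) / 2 - (a + 1) =
              (k + 1) / 2 - 1 - a by omega] at this) hq a
        have e₀ := abs_eval_iterate_derivative_mul_le (p := C ((k : ℝ) + 1) * cmom m k)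
          (c := fun a => ((k : ℝ) + 1) * c₀ a) (d := fun _ => 2) (e := k / 2) hm
          (A := (1 / (m : ℝ)) ^ (k - k / 2))
          (by positivity) zero_le_one (fun a => mul_nonneg (by positivity) (hc₀ a))
          (fun _ => zero_le_two)
          (fun a => by
            rw [iterate_derivative_C_mul, eval_mul, eval_C, abs_mul,
              abs_of_nonneg (by positivity : (0 : ℝ) ≤ (k : ℝ) + 1), mul_assoc]
            exact mul_le_mul_of_nonneg_left (h₀ m hm x hx a) (by positivity)) hq a
        have t₁ := pow_trade hu (inv_le_wt m x) (wt_le_one hm x) a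
          (E := k + 2 - (k + 2) / 2) (E' := 1 + (k + 1 - (k + 1) / 2))
          (f := (k + 2) / 2) (f' := (k + 1) / 2 - 1 + 1) (by omega) (by omega)
        have t₀ := pow_trade hu (inv_le_wt m x) (wt_le_one hm x) a
          (E := k + 2 - (k + 2) / 2) (E' := 1 + (k - k / 2))
          (f := (k + 2) / 2) (f' := k / 2 + 1) (by omega) (by omega)
        rw [cmom, iterate_derivative_C_mul, add_mul, iterate_map_add, eval_mul, eval_C,
          eval_add, abs_mul, abs_of_nonneg hu]
        set S₁ := ∑ j ∈ Finset.range (a + 1), (a.choose j : ℝ) * (c₁ (a - j + 1) * 2) with hS₁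
        set S₀ := ∑ j ∈ Finset.range (a + 1),
          (a.choose j : ℝ) * ((((k : ℝ) + 1) * c₀ (a - j)) * 2) with hS₀
        have hS₁0 : 0 ≤ S₁ := Finset.sum_nonneg fun j _ => by
          have := hc₁ (a - j + 1); positivity
        have hS₀0 : 0 ≤ S₀ := Finset.sum_nonneg fun j _ => by
          have := hc₀ (a - j); positivity
        refine (mul_le_mul_of_nonneg_left ((abs_add_le _ _).trans (add_le_add e₁ e₀)) hu).trans ?_
        have t₁' := mul_le_mul_of_nonneg_left t₁ hS₁0
        have t₀' := mul_le_mul_of_nonneg_left t₀ hS₀0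
        rw [pow_add _ 1, pow_one] at t₁' t₀'
        linarith

lemma natDegree_cmom_le (m k : ℕ) : (cmom m k).natDegree ≤ k := by
  induction k using Nat.strong_induction_on with
  | _ k ih =>
    match k with
    | 0 => simp [cmom]
    | 1 => simp [cmom]
    | (k + 2) =>
      rw [cmom]
      refine (natDegree_C_mul_le _ _).trans (natDegree_mul_le.trans ?_)
      have h1 := ih (k + 1) (by omega)
      have h0 := ih k (by omega)
      have h2 : (derivative (cmom m (k + 1)) + C ((k : ℝ) + 1) * cmom m k).natDegree ≤ k := by
        refine (natDegree_add_le _ _).trans (max_le ?_ ((natDegree_C_mul_le _ _).trans h0))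
        exact (natDegree_derivative_le _).trans (by omega)
      have h3 : (X - X ^ 2 : ℝ[X]).natDegree ≤ 2 :=
        (natDegree_sub_le _ _).trans (max_le (natDegree_X_le.trans (by norm_num)) (by simp))
      omega

/-- The action of `I - B_m` on polynomials of degree at most `d`. -/
noncomputable def errPoly (m d : ℕ) (Q : ℝ[X]) : ℝ[X] :=
  -∑ k ∈ Finset.Icc 2 d, C (1 / (k.factorial : ℝ)) * (cmom m k * derivative^[k] Q)

lemma natDegree_errPoly_le {m d : ℕ} {Q : ℝ[X]} (hQ : Q.natDegree ≤ d) :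
    (errPoly m d Q).natDegree ≤ d := by
  unfold errPoly
  rw [natDegree_neg]
  refine natDegree_sum_le_of_forall_le _ _ fun k hk => ?_
  refine (natDegree_C_mul_le _ _).trans (natDegree_mul_le.trans ?_)
  have h1 := natDegree_cmom_le m k
  have h2 := natDegree_iterate_derivative Q k
  by_cases h : k ≤ Q.natDegree
  · omega
  · rw [iterate_derivative_eq_zero (by omega)]
    simp
    have := (Finset.mem_Icc.mp hk).2
    omega

lemma eval_eq_sum_iterate_derivative {d : ℕ} {Q : ℝ[X]} (hQ : Q.natDegree ≤ d) (x y : ℝ) :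
    Q.eval y = ∑ k ∈ Finset.range (d + 1),
      1 / (k.factorial : ℝ) * (derivative^[k] Q).eval x * (y - x) ^ k := by
  have h := taylor_eval_sub x Q y
  rw [← h, eval_eq_sum_range' (n := d + 1) (by rw [natDegree_taylor]; omega)]
  refine Finset.sum_congr rfl fun k _ => ?_
  rw [taylor_coeff, ← factorial_smul_hasseDeriv]
  have : (k.factorial : ℝ) ≠ 0 := by positivity
  rw [LinearMap.smul_apply, eval_smul, nsmul_eq_mul]
  field_simp

lemma eval_errPoly {m d : ℕ} (hm : 1 ≤ m) (hd : 1 ≤ d) {Q : ℝ[X]} (hQ : Q.natDegree ≤ d) (x : ℝ) :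
    (errPoly m d Q).eval x = Q.eval x - Bop m (fun y => Q.eval y) x := by
  have h1 : Bop m (fun y => Q.eval y) x = ∑ k ∈ Finset.range (d + 1),
      1 / (k.factorial : ℝ) * ((cmom m k).eval x * (derivative^[k] Q).eval x) := by
    unfold Bop
    simp_rw [eval_eq_sum_iterate_derivative hQ x, Finset.mul_sum]
    rw [Finset.sum_comm]
    refine Finset.sum_congr rfl fun k _ => ?_
    rw [cmom_eval hm, Finset.sum_mul, Finset.mul_sum]
    exact Finset.sum_congr rfl fun i _ => by ring
  obtain ⟨n, rfl⟩ := Nat.exists_eq_add_of_le' hd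
  rw [h1, Finset.sum_range_succ', Finset.sum_range_succ', errPoly, eval_neg, eval_finsetSum,
    Finset.sum_bij' (t := Finset.range n) (g := fun k => 1 / ((k + 1 + 1).factorial : ℝ) *
      ((cmom m (k + 1 + 1)).eval x * (derivative^[k + 1 + 1] Q).eval x))
      (fun k _ => k - 2) (fun k _ => k + 2)]
  · simp [cmom]
  · intro a ha
    have := Finset.mem_Icc.mp ha
    exact Finset.mem_range.mpr (by omega)
  · intro a ha
    have := Finset.mem_range.mp ha
    exact Finset.mem_Icc.mpr (by omega)
  · intro a ha
    have := Finset.mem_Icc.mp ha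
    omega
  · intro a ha
    omega
  · intro a ha
    have := Finset.mem_Icc.mp ha
    rw [show a - 2 + 1 + 1 = a by omega]
    simp

lemma exists_abs_eval_iterate_derivative_errPoly_le (d : ℕ) : ∃ K : ℝ, 0 ≤ K ∧
    ∀ m : ℕ, 1 ≤ m → ∀ x ∈ Icc (0 : ℝ) 1, ∀ Q : ℝ[X], Q.natDegree ≤ d → ∀ (s : ℕ) (M : ℝ), 0 ≤ M →
      (∀ i, |(derivative^[i] Q).eval x| ≤ M * wt m x ^ (s - i)) →
      ∀ i, |(derivative^[i] (errPoly m d Q)).eval x| ≤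
        K * (1 / (m : ℝ) * M) * wt m x ^ (max 1 (s - 1) - i) := by
  choose c hc h using exists_abs_eval_iterate_derivative_cmom_le
  set K : ℕ → ℝ := fun i => ∑ k ∈ Finset.Icc 2 d, ∑ j ∈ Finset.range (i + 1),
    (i.choose j : ℝ) * (c k (i - j) * 1) with hK
  have hK0 : ∀ i, 0 ≤ K i := fun i => Finset.sum_nonneg fun k _ => Finset.sum_nonneg fun j _ => by
    have := hc k (i - j); positivity
  refine ⟨∑ i ∈ Finset.range (d + 1), K i, Finset.sum_nonneg fun i _ => hK0 i, ?_⟩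
  intro m hm x hx Q hQ s M hM hs i
  have hw := wt_pos hm x
  have hu : 0 ≤ 1 / (m : ℝ) := by positivity
  by_cases hi : d < i
  · rw [iterate_derivative_eq_zero ((natDegree_errPoly_le hQ).trans_lt hi), eval_zero, abs_zero]
    have := Finset.sum_nonneg fun i (_ : i ∈ Finset.range (d + 1)) => hK0 i
    positivity
  have hle : K i ≤ ∑ i ∈ Finset.range (d + 1), K i :=
    Finset.single_le_sum (fun i _ => hK0 i) (Finset.mem_range.mpr (by omega))
  refine le_trans ?_ (mul_le_mul_of_nonneg_right (mul_le_mul_of_nonneg_right hle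
    (mul_nonneg hu hM)) (pow_nonneg hw.le _))
  rw [errPoly, iterate_derivative_neg, eval_neg, abs_neg, iterate_derivative_sum, eval_finsetSum,
    mul_assoc, hK, Finset.sum_mul]
  refine (Finset.abs_sum_le_sum_abs _ _).trans (Finset.sum_le_sum fun k hk => ?_)
  have hk2 := (Finset.mem_Icc.mp hk).1
  have e := abs_eval_iterate_derivative_mul_le (p := cmom m k) (q := derivative^[k] Q)
    (c := c k) (d := fun _ => 1) (A := 1 / (m : ℝ)) (B := M) (e := k - 1) (f := s - k) hm
    hu hM (hc k) (fun _ => zero_le_one)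
    (fun a => (h k m hm x hx a).trans (mul_le_mul_of_nonneg_left (by
      have := pow_trade hu (inv_le_wt m x) (wt_le_one hm x) a
          (E := 1) (E' := k - k / 2) (f := k - 1) (f' := k / 2) (by omega) (by omega)
      rwa [pow_one] at this) (hc k a)))
    (fun a => by
      rw [← Function.iterate_add_apply, one_mul]
      exact (hs (a + k)).trans_eq (by congr 2; omega)) i
  rw [iterate_derivative_C_mul, eval_mul, eval_C, abs_mul]
  have hf : |1 / (k.factorial : ℝ)| ≤ 1 := by
    rw [abs_of_nonneg (by positivity)]
    exact div_le_one_of_le₀ (by exact_mod_cast Nat.one_le_iff_ne_zero.mpr k.factorial_ne_zero)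
      (by positivity)
  refine (mul_le_of_le_one_left (abs_nonneg _) hf).trans (e.trans ?_)
  refine mul_le_mul_of_nonneg_left (mul_le_mul_of_nonneg_left ?_ (mul_nonneg hu hM))
    (Finset.sum_nonneg fun j _ => ?_)
  · exact pow_le_pow_of_le_one hw.le (wt_le_one hm x) (by omega)
  · have := hc k (i - j); positivity

/-- `(I - B_m)^l` nearly annihilates the shifted monomials at their base point. -/
lemma exists_abs_errLin_pow_le (d l : ℕ) (hd : 1 ≤ d) (hl : 1 ≤ l) : ∃ K : ℝ, 0 ≤ K ∧
    ∀ m : ℕ, 1 ≤ m → ∀ x ∈ Icc (0 : ℝ) 1, ∀ j ≤ d,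
      |errLin m l (fun u => (u - x) ^ j) x| ≤
        K * (1 / (m : ℝ)) ^ l * wt m x ^ max 1 (j - l) := by
  obtain ⟨K, hK, h⟩ := exists_abs_eval_iterate_derivative_errPoly_le d
  have key : ∀ n : ℕ, ∀ m : ℕ, 1 ≤ m → ∀ x ∈ Icc (0 : ℝ) 1, ∀ j ≤ d, ∃ Q : ℝ[X],
      Q.natDegree ≤ d ∧ errLin m n (fun u => (u - x) ^ j) = (fun u => Q.eval u) ∧
      ∀ i, |(derivative^[i] Q).eval x| ≤ (K * (1 / (m : ℝ))) ^ n * j.factorial *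
        wt m x ^ ((if n = 0 then j else max 1 (j - n)) - i) := by
    intro n m hm x hx j hj
    have hw := wt_pos hm x
    have hu : 0 ≤ 1 / (m : ℝ) := by positivity
    induction n with
    | zero =>
      refine ⟨(X - C x) ^ j, (natDegree_pow_le.trans (by simp)).trans hj, ?_, fun i => ?_⟩
      · rw [errLin_zero]; simp
      · rw [iterate_derivative_X_sub_pow, nsmul_eq_mul, eval_mul, eval_natCast, abs_mul,
          Nat.abs_cast]
        simp only [eval_pow, eval_sub, eval_X, eval_C, sub_self, if_true, pow_zero, one_mul]
        rcases lt_trichotomy i j with hij | hij | hij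
        · rw [zero_pow (by omega), abs_zero, mul_zero]; positivity
        · subst hij; simp [Nat.descFactorial_self]
        · rw [Nat.descFactorial_of_lt hij]; simp; positivity
    | succ n ih =>
      obtain ⟨Q, hQd, hQ, hb⟩ := ih
      refine ⟨errPoly m d Q, natDegree_errPoly_le hQd, ?_, fun i => ?_⟩
      · rw [errLin_succ, hQ]
        funext u
        rw [eval_errPoly hm hd hQd]; rfl
      · refine (h m hm x hx Q hQd _ _ (by positivity) hb i).trans ?_
        rw [pow_succ, if_neg (Nat.succ_ne_zero n)]
        have e : K * (1 / (m : ℝ) * ((K * (1 / (m : ℝ))) ^ n * j.factorial)) =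
          (K * (1 / (m : ℝ))) ^ n * (K * (1 / (m : ℝ))) * j.factorial := by ring
        rw [e]
        refine mul_le_mul_of_nonneg_left (pow_le_pow_of_le_one hw.le (wt_le_one hm x) ?_)
          (by positivity)
        split_ifs with h0
        · subst h0; omega
        · omega
  refine ⟨K ^ l * d.factorial, by positivity, fun m hm x hx j hj => ?_⟩
  obtain ⟨Q, -, hQ, hb⟩ := key l m hm x hx j hj
  have hw := wt_pos hm x
  have h0 := hb 0
  rw [hQ]
  rw [Function.iterate_zero, id, if_neg (by omega), mul_pow, tsub_zero] at h0
  refine h0.trans (mul_le_mul_of_nonneg_right ?_ (by positivity))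
  have : (j.factorial : ℝ) ≤ d.factorial := by exact_mod_cast Nat.factorial_le hj
  calc K ^ l * (1 / (m : ℝ)) ^ l * j.factorial ≤ K ^ l * (1 / (m : ℝ)) ^ l * d.factorial := by
        gcongr
    _ = _ := by ring

lemma add_pow_le_two_pow_mul {a b : ℝ} (ha : 0 ≤ a) (hb : 0 ≤ b) (n : ℕ) :
    (a + b) ^ n ≤ 2 ^ n * (a ^ n + b ^ n) := by
  have h : (a + b) ^ n ≤ (2 * max a b) ^ n :=
    pow_le_pow_left₀ (by positivity) (by linarith [le_max_left a b, le_max_right a b]) n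
  refine h.trans ?_
  rw [mul_pow]
  refine mul_le_mul_of_nonneg_left ?_ (by positivity)
  rcases max_cases a b with ⟨h, _⟩ | ⟨h, _⟩ <;> rw [h] <;> linarith [pow_nonneg ha n, pow_nonneg hb n]

lemma wt_le_add (m : ℕ) {x u : ℝ} (hx : x ∈ Icc (0 : ℝ) 1) (hu : u ∈ Icc (0 : ℝ) 1) :
    wt m u ≤ wt m x + |u - x| := by
  refine max_le ?_ ((inv_le_wt m x).trans (by linarith [abs_nonneg (u - x)]))
  have h1 := le_wt m x
  have h2 : u * (1 - u) - x * (1 - x) = (u - x) * (1 - u - x) := by ring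
  have h3 : (u - x) * (1 - u - x) ≤ |u - x| * 1 := by
    refine (le_abs_self _).trans ?_
    rw [abs_mul]
    exact mul_le_mul_of_nonneg_left (abs_le.mpr ⟨by linarith [hx.2, hu.2], by linarith [hx.1, hu.1]⟩)
      (abs_nonneg _)
  linarith

/-- `B_m` maps `(· - x)^(2l) + (w(x)/m)^l` into a multiple of itself. -/
lemma exists_Bop_pow_add_le (l : ℕ) : ∃ K : ℝ, 0 ≤ K ∧ ∀ m : ℕ, 1 ≤ m →
    ∀ x ∈ Icc (0 : ℝ) 1, ∀ u ∈ Icc (0 : ℝ) 1,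
      Bop m (fun v => (v - x) ^ (2 * l) + (wt m x * (1 / (m : ℝ))) ^ l) u ≤
        K * ((u - x) ^ (2 * l) + (wt m x * (1 / (m : ℝ))) ^ l) := by
  obtain ⟨c, hc, h⟩ := exists_abs_eval_iterate_derivative_cmom_le (2 * l)
  refine ⟨2 ^ (2 * l) * (1 + c 0 * (2 ^ l * 2)) + 1, by have := hc 0; positivity, ?_⟩
  intro m hm x hx u hu
  have hc0 := hc 0
  have hwx := wt_pos hm x
  have hwu := wt_pos hm u
  have hi : 0 ≤ 1 / (m : ℝ) := by positivity
  set a := |u - x| with ha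
  have ha0 : 0 ≤ a := abs_nonneg _
  have ha2 : (u - x) ^ (2 * l) = a ^ (2 * l) := by rw [pow_mul, pow_mul, ha, sq_abs]
  set W := (wt m x * (1 / (m : ℝ))) ^ l with hW
  have hW0 : 0 ≤ W := by positivity
  have hmom := h m hm u hu 0
  rw [Function.iterate_zero, id, cmom_eval hm, show 2 * l - 2 * l / 2 = l by omega,
    show 2 * l / 2 - 0 = l by omega, ← mul_pow] at hmom
  have hmom' := (le_abs_self _).trans hmom
  have hsplit : Bop m (fun v => (v - x) ^ (2 * l) + W) u ≤
      2 ^ (2 * l) * (a ^ (2 * l) +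
        ∑ i ∈ Finset.range (m + 1), bern m i u * ((i : ℝ) / m - u) ^ (2 * l)) + W := by
    have e : 2 ^ (2 * l) * (a ^ (2 * l) +
        ∑ i ∈ Finset.range (m + 1), bern m i u * ((i : ℝ) / m - u) ^ (2 * l)) + W =
        Bop m (fun v => 2 ^ (2 * l) * (a ^ (2 * l) + (v - u) ^ (2 * l)) + W) u := by
      simp only [Bop, mul_add, Finset.sum_add_distrib]
      rw [← Finset.sum_mul, ← Finset.sum_mul, sum_bern, Finset.mul_sum]
      simp only [one_mul]
      congr 2
      exact Finset.sum_congr rfl fun i _ => by ring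
    rw [e]
    refine Bop_mono (fun v hv => ?_) hu
    have h1 := add_pow_le_two_pow_mul ha0 (abs_nonneg (v - u)) (2 * l)
    have h2 : (v - x) ^ (2 * l) ≤ (a + |v - u|) ^ (2 * l) := by
      have : (v - x) ^ (2 * l) = |v - x| ^ (2 * l) := by rw [pow_mul, pow_mul, sq_abs]
      rw [this]
      refine pow_le_pow_left₀ (abs_nonneg _) ?_ _
      rw [show v - x = (u - x) + (v - u) by ring]
      exact abs_add_le _ _
    have h3 : |v - u| ^ (2 * l) = (v - u) ^ (2 * l) := by rw [pow_mul, pow_mul, sq_abs]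
    rw [h3] at h1
    linarith
  have hwu' : (1 / (m : ℝ) * wt m u) ^ l ≤ 2 ^ l * (2 * W + a ^ (2 * l)) := by
    have h1 : 1 / (m : ℝ) * wt m u ≤ wt m x * (1 / m) + 1 / m * a := by
      nlinarith [mul_le_mul_of_nonneg_left (wt_le_add m hx hu) hi]
    refine (pow_le_pow_left₀ (by positivity) h1 l).trans ?_
    refine (add_pow_le_two_pow_mul (by positivity) (by positivity) l).trans ?_
    refine mul_le_mul_of_nonneg_left ?_ (by positivity)
    have h2 : (1 / (m : ℝ) * a) ^ l ≤ W + a ^ (2 * l) := by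
      rcases le_total a (1 / (m : ℝ)) with h | h
      · have : (1 / (m : ℝ) * a) ^ l ≤ W := by
          refine pow_le_pow_left₀ (by positivity) ?_ l
          rw [mul_comm]
          exact mul_le_mul_of_nonneg_right (h.trans (inv_le_wt m x)) hi
        linarith [pow_nonneg ha0 (2 * l)]
      · have : (1 / (m : ℝ) * a) ^ l ≤ a ^ (2 * l) := by
          rw [pow_mul, sq]
          exact pow_le_pow_left₀ (by positivity) (mul_le_mul_of_nonneg_right h ha0) l
        linarith
    linarith
  rw [ha2]
  have h5 := mul_le_mul_of_nonneg_left hwu' hc0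
  have hA := pow_nonneg ha0 (2 * l)
  calc _ ≤ 2 ^ (2 * l) * (a ^ (2 * l) + c 0 * (2 ^ l * (2 * W + a ^ (2 * l)))) + W := by
        refine hsplit.trans ?_
        gcongr
        exact hmom'.trans h5
    _ ≤ _ := by
        have p1 : 0 ≤ (2 : ℝ) ^ (2 * l) * W := by positivity
        have p2 : 0 ≤ (2 : ℝ) ^ (2 * l) * (c 0 * 2 ^ l * a ^ (2 * l)) := by positivity
        nlinarith

lemma wt_segment {m : ℕ} {x u y : ℝ} (hu : u ∈ Icc (0 : ℝ) 1)
    (hy : y ∈ Icc (0 : ℝ) 1) : (1 - y) * wt m x ≤ wt m (x + (u - x) * y) := by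
  have hy0 := hy.1
  have hy1 : 0 ≤ 1 - y := by linarith [hy.2]
  unfold wt
  rcases max_cases (x * (1 - x)) (1 / (m : ℝ)) with ⟨h, _⟩ | ⟨h, _⟩ <;> rw [h]
  · refine le_trans ?_ (le_max_left _ _)
    have h1 : 0 ≤ u * (1 - u) := mul_nonneg hu.1 (by linarith [hu.2])
    have h2 : 0 ≤ y * (u * (1 - u)) := mul_nonneg hy0 h1
    have h3 : 0 ≤ y * (1 - y) * (u - x) ^ 2 := by positivity
    nlinarith
  · refine le_trans ?_ (le_max_right _ _)
    exact mul_le_of_le_one_left (by positivity) (by linarith)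

end

lemma iteratedDeriv_comp_add_mul {n : ℕ} {F : ℝ → ℝ} (hF : ContDiff ℝ n F) (x d : ℝ) :
    iteratedDeriv n (fun y => F (x + d * y)) = fun y => d ^ n * iteratedDeriv n F (x + d * y) := by
  have h1 : ContDiff ℝ n (fun z => F (x + z)) := hF.comp (contDiff_const.add contDiff_id)
  have h2 := iteratedDeriv_comp_const_mul h1 d
  rw [iteratedDeriv_comp_const_add] at h2
  exact h2

/-- Taylor's formula with the Cauchy form of the remainder. -/
lemma exists_taylor_cauchy {n : ℕ} {F : ℝ → ℝ} (hF : ContDiff ℝ (n + 1 : ℕ) F) (x d : ℝ) :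
    ∃ ξ ∈ Ioo (0 : ℝ) 1, F (x + d) =
      (∑ j ∈ Finset.range (n + 1), iteratedDeriv j F x / j.factorial * d ^ j) +
        iteratedDeriv (n + 1) F (x + d * ξ) * d ^ (n + 1) * (1 - ξ) ^ n / n.factorial := by
  set G : ℝ → ℝ := fun y => F (x + d * y) with hG
  have hGc : ContDiff ℝ (n + 1 : ℕ) G :=
    hF.comp (contDiff_const.add (contDiff_const.mul contDiff_id))
  have hit : ∀ j ≤ n + 1, ∀ y ∈ Icc (0 : ℝ) 1, iteratedDerivWithin j G (Icc 0 1) y =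
      d ^ j * iteratedDeriv j F (x + d * y) := by
    intro j hj y hy
    have hj' : ((j : ℕ) : WithTop ℕ∞) ≤ ((n + 1 : ℕ) : WithTop ℕ∞) := by exact_mod_cast hj
    rw [iteratedDerivWithin_eq_iteratedDeriv (uniqueDiffOn_Icc zero_lt_one)
      (hGc.of_le hj').contDiffAt hy, hG, iteratedDeriv_comp_add_mul (hF.of_le hj')]
  have hu : uIcc (0 : ℝ) 1 = Icc 0 1 := uIcc_of_le zero_le_one
  have hdiff : DifferentiableOn ℝ (iteratedDerivWithin n G (uIcc 0 1)) (uIoo (0 : ℝ) 1) := by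
    have h1 := hGc.contDiffOn.differentiableOn_iteratedDerivWithin (s := Icc (0 : ℝ) 1) (m := n)
      (by exact_mod_cast Nat.lt_succ_self n) (uniqueDiffOn_Icc zero_lt_one)
    rw [hu, uIoo_of_le zero_le_one]
    exact h1.mono Ioo_subset_Icc_self
  obtain ⟨ξ, hξ, h⟩ := taylor_mean_remainder_cauchy (f := G) (x := 1) (x₀ := 0) (n := n)
    zero_ne_one (hGc.of_le (by exact_mod_cast Nat.le_succ n)).contDiffOn hdiff
  rw [uIoo_of_le zero_le_one] at hξ
  refine ⟨ξ, hξ, ?_⟩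
  rw [hu, taylor_within_apply, hit (n + 1) le_rfl ξ (Ioo_subset_Icc_self hξ)] at h
  have hG1 : G 1 = F (x + d) := by simp [hG]
  rw [hG1] at h
  have hs : ∑ k ∈ Finset.range (n + 1), ((k.factorial : ℝ)⁻¹ * (1 - 0) ^ k) •
      iteratedDerivWithin k G (Icc 0 1) 0 =
      ∑ j ∈ Finset.range (n + 1), iteratedDeriv j F x / j.factorial * d ^ j := by
    refine Finset.sum_congr rfl fun k hk => ?_
    rw [hit k (by have := Finset.mem_range.mp hk; omega) 0 (by simp)]
    simp
    ring
  rw [hs] at h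
  rw [sub_eq_iff_eq_add'] at h
  rw [h]
  ring

/-- Approximation order of `(I - B_m)^l` on functions with weighted derivative bounds. -/
theorem exists_abs_errLin_le_of_iteratedDeriv (l : ℕ) (hl : 1 ≤ l) : ∃ K : ℝ, 0 ≤ K ∧
    ∀ m : ℕ, 1 ≤ m → ∀ F : ℝ → ℝ, ContDiff ℝ (2 * l : ℕ) F → ∀ M : ℝ, 0 ≤ M →
      (∀ j < 2 * l, ∀ x ∈ Icc (0 : ℝ) 1, |iteratedDeriv j F x| ≤ M / wt m x ^ max 1 (j - l)) →
      (∀ x ∈ Icc (0 : ℝ) 1, |iteratedDeriv (2 * l) F x| ≤ M / wt m x ^ l) →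
      ∀ x ∈ Icc (0 : ℝ) 1, |errLin m l F x| ≤ K * M * (1 / (m : ℝ)) ^ l := by
  obtain ⟨K₁, hK₁, h₁⟩ := exists_abs_errLin_pow_le (2 * l) l (by omega) hl
  obtain ⟨K₂, hK₂, h₂⟩ := exists_Bop_pow_add_le l
  refine ⟨2 * l * K₁ + (1 + K₂) ^ l, by positivity, fun m hm F hF M hM hj hr x hx => ?_⟩
  have hw := wt_pos hm x
  have hi : 0 ≤ 1 / (m : ℝ) := by positivity
  set P : ℕ → ℝ → ℝ := fun j u => (u - x) ^ j with hP
  set R : ℝ → ℝ := F - ∑ j ∈ Finset.range (2 * l),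
    (iteratedDeriv j F x / j.factorial) • P j with hR
  have hRb : ∀ u ∈ Icc (0 : ℝ) 1, |((wt m x ^ l) • R) u| ≤
      M * ((u - x) ^ (2 * l) + (wt m x * (1 / (m : ℝ))) ^ l) := by
    intro u hu
    obtain ⟨ξ, hξ, h⟩ := exists_taylor_cauchy (n := 2 * l - 1)
      (by rwa [show 2 * l - 1 + 1 = 2 * l by omega]) x (u - x)
    rw [show 2 * l - 1 + 1 = 2 * l by omega, add_sub_cancel] at h
    have hξ' : ξ ∈ Icc (0 : ℝ) 1 := Ioo_subset_Icc_self hξ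
    have h1ξ : 0 < 1 - ξ := by linarith [hξ.2]
    have hRu : R u = iteratedDeriv (2 * l) F (x + (u - x) * ξ) * (u - x) ^ (2 * l) *
        (1 - ξ) ^ (2 * l - 1) / (2 * l - 1).factorial := by
      rw [hR, Pi.sub_apply, h, Finset.sum_apply]
      simp [hP]
    have hv : x + (u - x) * ξ ∈ Icc (0 : ℝ) 1 := by
      constructor <;> nlinarith [hx.1, hx.2, hu.1, hu.2, hξ'.1]
    have hsq : 0 ≤ (u - x) ^ (2 * l) := by rw [pow_mul]; positivity
    have hwv := wt_pos hm (x + (u - x) * ξ)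
    have hD : wt m x ^ l * (|iteratedDeriv (2 * l) F (x + (u - x) * ξ)| * (1 - ξ) ^ (2 * l - 1))
        ≤ M := by
      have e1 := hr _ hv
      have e2 : ((1 - ξ) * wt m x) ^ l ≤ wt m (x + (u - x) * ξ) ^ l :=
        pow_le_pow_left₀ (by positivity) (wt_segment hu hξ') l
      have e3 : (1 - ξ) ^ (2 * l - 1) ≤ (1 - ξ) ^ l :=
        pow_le_pow_of_le_one h1ξ.le (by linarith [hξ.1]) (by omega)
      rw [le_div_iff₀ (by positivity)] at e1
      calc _ ≤ wt m x ^ l * (|iteratedDeriv (2 * l) F (x + (u - x) * ξ)| * (1 - ξ) ^ l) := by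
            gcongr
        _ = |iteratedDeriv (2 * l) F (x + (u - x) * ξ)| * ((1 - ξ) * wt m x) ^ l := by
            rw [mul_pow]; ring
        _ ≤ _ := (mul_le_mul_of_nonneg_left e2 (abs_nonneg _)).trans e1
    have hfac : (1 : ℝ) ≤ (2 * l - 1).factorial := by
      exact_mod_cast Nat.one_le_iff_ne_zero.mpr (Nat.factorial_ne_zero _)
    rw [Pi.smul_apply, smul_eq_mul, hRu, abs_mul, abs_div, abs_mul, abs_mul, abs_of_nonneg hsq,
      abs_of_nonneg (by positivity : 0 ≤ wt m x ^ l),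
      abs_of_nonneg (by positivity : 0 ≤ (1 - ξ) ^ (2 * l - 1)),
      Nat.abs_cast]
    calc _ ≤ wt m x ^ l * (|iteratedDeriv (2 * l) F (x + (u - x) * ξ)| * (u - x) ^ (2 * l) *
            (1 - ξ) ^ (2 * l - 1)) :=
          mul_le_mul_of_nonneg_left (div_le_self (by positivity) hfac) (by positivity)
      _ = (wt m x ^ l * (|iteratedDeriv (2 * l) F (x + (u - x) * ξ)| * (1 - ξ) ^ (2 * l - 1))) *
            (u - x) ^ (2 * l) := by ring
      _ ≤ M * (u - x) ^ (2 * l) := mul_le_mul_of_nonneg_right hD hsq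
      _ ≤ _ := mul_le_mul_of_nonneg_left (by
          have : 0 ≤ (wt m x * (1 / (m : ℝ))) ^ l := by positivity
          linarith) hM
  have hRx : |errLin m l R x| ≤ (1 + K₂) ^ l * M * (1 / (m : ℝ)) ^ l := by
    have h := abs_errLin_le (m := m) (c := K₂)
      (E := fun u => M * ((u - x) ^ (2 * l) + (wt m x * (1 / (m : ℝ))) ^ l)) (fun u hu => by
        have e : Bop m (fun u => M * ((u - x) ^ (2 * l) + (wt m x * (1 / (m : ℝ))) ^ l)) u =
          M * Bop m (fun u => ((u - x) ^ (2 * l) + (wt m x * (1 / (m : ℝ))) ^ l)) u :=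
          congrFun ((BopLin m).map_smul M
            (fun u => (u - x) ^ (2 * l) + (wt m x * (1 / (m : ℝ))) ^ l)) u
        rw [e]
        have := mul_le_mul_of_nonneg_left (h₂ m hm x hx u hu) hM
        linarith) hRb l x hx
    rw [map_smul, Pi.smul_apply, smul_eq_mul, abs_mul, abs_of_nonneg (by positivity), sub_self,
      zero_pow (by omega), zero_add, mul_pow] at h
    have hwl : 0 < wt m x ^ l := by positivity
    refine le_of_mul_le_mul_left ?_ hwl
    linarith
  have hF' : F = R + ∑ j ∈ Finset.range (2 * l), (iteratedDeriv j F x / j.factorial) • P j := by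
    rw [hR, sub_add_cancel]
  have hsum : |(∑ j ∈ Finset.range (2 * l),
      (iteratedDeriv j F x / j.factorial) • errLin m l (P j)) x| ≤
      2 * l * K₁ * M * (1 / (m : ℝ)) ^ l := by
    rw [Finset.sum_apply]
    refine (Finset.abs_sum_le_sum_abs _ _).trans ?_
    have e : (2 * l * K₁ * M * (1 / (m : ℝ)) ^ l) =
        ∑ j ∈ Finset.range (2 * l), K₁ * M * (1 / (m : ℝ)) ^ l := by
      rw [Finset.sum_const, Finset.card_range, nsmul_eq_mul]; push_cast; ring
    rw [e]
    refine Finset.sum_le_sum fun j hj' => ?_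
    have hj2 := Finset.mem_range.mp hj'
    have hfac : (1 : ℝ) ≤ j.factorial := by
      exact_mod_cast Nat.one_le_iff_ne_zero.mpr (Nat.factorial_ne_zero _)
    rw [Pi.smul_apply, smul_eq_mul, abs_mul, abs_div, Nat.abs_cast]
    have e1 : |iteratedDeriv j F x| / j.factorial ≤ M / wt m x ^ max 1 (j - l) :=
      (div_le_self (abs_nonneg _) hfac).trans (hj j hj2 x hx)
    refine (mul_le_mul e1 (h₁ m hm x hx j hj2.le) (abs_nonneg _) (by positivity)).trans_eq ?_
    field_simp
  rw [hF', map_add, map_sum, Pi.add_apply]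
  simp_rw [map_smul]
  refine (abs_add_le _ _).trans ?_
  linarith

/-- Bounds on a function and its `r`-th derivative control the intermediate derivatives. -/
lemma exists_abs_iteratedDeriv_mul_le (r : ℕ) (hr : 1 ≤ r) : ∃ K : ℝ, 1 ≤ K ∧
    ∀ G : ℝ → ℝ, ContDiff ℝ r G → ∀ x d A B : ℝ,
      (∀ y ∈ Icc (0 : ℝ) 1, |G (x + d * y)| ≤ A) →
      (∀ y ∈ Icc (0 : ℝ) 1, |iteratedDeriv r G (x + d * y)| ≤ B) →
      ∀ i ≤ r, |iteratedDeriv i G x| * |d| ^ i ≤ K * (A + B * |d| ^ r) := by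
  obtain ⟨n, rfl⟩ := Nat.exists_eq_add_of_le' hr
  set y : Fin (n + 1) → ℝ := fun j => (j : ℝ) / (n + 1 : ℕ) with hy
  have hyinj : Function.Injective y := by
    intro a b hab
    have : (a : ℝ) = (b : ℝ) := by
      simp only [hy] at hab
      field_simp at hab
      exact hab
    exact Fin.ext (by exact_mod_cast this)
  have hy01 : ∀ j, y j ∈ Icc (0 : ℝ) 1 := fun j => by
    refine ⟨by positivity, div_le_one_of_le₀ ?_ (by positivity)⟩
    exact_mod_cast j.2.le
  set V := Matrix.vandermonde y with hV
  have hdet : IsUnit V.det := (Matrix.det_vandermonde_ne_zero_iff.mpr hyinj).isUnit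
  set S : ℝ := ∑ i, ∑ j, |V⁻¹ i j| with hS
  have hS0 : 0 ≤ S := Finset.sum_nonneg fun i _ => Finset.sum_nonneg fun j _ => abs_nonneg _
  refine ⟨(n + 1).factorial * S + 1, by nlinarith [(n + 1).factorial.cast_nonneg (α := ℝ)], ?_⟩
  intro G hG x d A B hA hB i hi
  have hA0 : 0 ≤ A := (abs_nonneg _).trans (hA 0 (by simp))
  have hB0 : 0 ≤ B := (abs_nonneg _).trans (hB 0 (by simp))
  have hd0 := abs_nonneg d
  have hE0 : 0 ≤ A + B * |d| ^ (n + 1) := by positivity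
  rcases hi.lt_or_eq with hlt | rfl
  · set c : Fin (n + 1) → ℝ := fun k => iteratedDeriv k G x / (k : ℕ).factorial * d ^ (k : ℕ) with hc
    have hVc : ∀ j, |(V.mulVec c) j| ≤ A + B * |d| ^ (n + 1) := by
      intro j
      obtain ⟨ξ, hξ, h⟩ := exists_taylor_cauchy hG x (d * y j)
      have e1 : (V.mulVec c) j = ∑ k ∈ Finset.range (n + 1),
          iteratedDeriv k G x / k.factorial * (d * y j) ^ k := by
        rw [← Fin.sum_univ_eq_sum_range
          (fun k => iteratedDeriv k G x / k.factorial * (d * y j) ^ k)]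
        simp only [Matrix.mulVec, dotProduct, hV, Matrix.vandermonde_apply, hc]
        exact Finset.sum_congr rfl fun k _ => by rw [mul_pow]; ring
      rw [← e1] at h
      have e2 : (V.mulVec c) j = G (x + d * y j) - iteratedDeriv (n + 1) G (x + d * y j * ξ) *
          (d * y j) ^ (n + 1) * (1 - ξ) ^ n / n.factorial := by linarith
      have hξ0 := hξ.1
      have hξ1 : 0 ≤ 1 - ξ := by linarith [hξ.2]
      have hyj := hy01 j
      have hyj0 := hyj.1
      rw [e2]
      refine (abs_sub _ _).trans (add_le_add (hA _ hyj) ?_)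
      have hfac : (1 : ℝ) ≤ n.factorial := by
        exact_mod_cast Nat.one_le_iff_ne_zero.mpr (Nat.factorial_ne_zero _)
      rw [abs_div, abs_mul, abs_mul, Nat.abs_cast, abs_pow, abs_pow, abs_mul,
        abs_of_nonneg hξ1, abs_of_nonneg hyj0, mul_assoc d]
      refine (div_le_self (by positivity) hfac).trans ?_
      have b1 := hB (y j * ξ) ⟨by positivity, mul_le_one₀ hyj.2 hξ0.le hξ.2.le⟩
      have b2 : (1 - ξ) ^ n ≤ 1 := pow_le_one₀ hξ1 (by linarith)
      have b3 : (|d| * y j) ^ (n + 1) ≤ |d| ^ (n + 1) :=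
        pow_le_pow_left₀ (by positivity) (mul_le_of_le_one_right hd0 hyj.2) _
      calc _ ≤ B * |d| ^ (n + 1) * 1 := by gcongr
        _ = _ := mul_one _
    have hinv : c = V⁻¹.mulVec (V.mulVec c) := by
      rw [Matrix.mulVec_mulVec, Matrix.nonsing_inv_mul V hdet, Matrix.one_mulVec]
    have hci : |c ⟨i, hlt⟩| ≤ S * (A + B * |d| ^ (n + 1)) := by
      rw [hinv]
      simp only [Matrix.mulVec, dotProduct]
      refine (Finset.abs_sum_le_sum_abs _ _).trans ?_
      calc _ ≤ ∑ j, |V⁻¹ ⟨i, hlt⟩ j| * (A + B * |d| ^ (n + 1)) :=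
            Finset.sum_le_sum fun j _ => by
              rw [abs_mul]; exact mul_le_mul_of_nonneg_left (hVc j) (abs_nonneg _)
        _ = (∑ j, |V⁻¹ ⟨i, hlt⟩ j|) * (A + B * |d| ^ (n + 1)) := by rw [Finset.sum_mul]
        _ ≤ _ := mul_le_mul_of_nonneg_right
            (Finset.single_le_sum (f := fun i => ∑ j, |V⁻¹ i j|)
              (fun i _ => Finset.sum_nonneg fun j _ => abs_nonneg _) (Finset.mem_univ _)) hE0
    have hfac : (i.factorial : ℝ) ≤ (n + 1).factorial := by exact_mod_cast Nat.factorial_le hi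
    have e3 : |iteratedDeriv i G x| * |d| ^ i = i.factorial * |c ⟨i, hlt⟩| := by
      simp only [hc, abs_mul, abs_div, abs_pow, Nat.abs_cast]
      field_simp
    rw [e3]
    calc _ ≤ ((n + 1).factorial : ℝ) * (S * (A + B * |d| ^ (n + 1))) := by gcongr
      _ ≤ _ := by nlinarith
  · have := hB 0 (by simp)
    rw [mul_zero, add_zero] at this
    have h1 : |iteratedDeriv (n + 1) G x| * |d| ^ (n + 1) ≤ B * |d| ^ (n + 1) := by gcongr
    have h2 : 0 ≤ ((n + 1).factorial : ℝ) * S * (A + B * |d| ^ (n + 1)) := by positivity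
    linarith

lemma wt_reflect (m : ℕ) (x : ℝ) : wt m (1 + -1 * x) = wt m x := by
  unfold wt
  congr 1
  ring

lemma wt_bounds_right (m : ℕ) {v : ℝ} (hv : v ∈ Icc (1 / 2 : ℝ) 1) :
    (1 - v + 1 / (m : ℝ)) / 4 ≤ wt m v ∧ wt m v ≤ 1 - v + 1 / (m : ℝ) := by
  have h0 := hv.1
  have h1 := hv.2
  have hm : 0 ≤ 1 / (m : ℝ) := by positivity
  have e1 := le_wt m v
  have e2 := inv_le_wt m v
  refine ⟨by nlinarith, max_le (by nlinarith) (by linarith)⟩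

lemma hasDerivAt_iteratedDeriv {n j : ℕ} {F : ℝ → ℝ} (hF : ContDiff ℝ n F) (hj : j < n) (x : ℝ) :
    HasDerivAt (iteratedDeriv j F) (iteratedDeriv (j + 1) F x) x := by
  rw [iteratedDeriv_succ]
  exact ((hF.differentiable_iteratedDeriv j (by exact_mod_cast hj)) x).hasDerivAt

lemma exists_abs_iteratedDeriv_le_right (l : ℕ) (hl : 1 ≤ l) (i : ℕ) (hi : i ≤ 2 * l) :
    ∃ C : ℝ, 0 ≤ C ∧
    ∀ m : ℕ, 1 ≤ m → ∀ F : ℝ → ℝ, ContDiff ℝ (2 * l : ℕ) F → ∀ M : ℝ, 0 ≤ M →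
      (∀ x ∈ Icc (0 : ℝ) 1, |F x| ≤ M) →
      (∀ x ∈ Icc (0 : ℝ) 1, |iteratedDeriv (2 * l) F x| ≤ M / wt m x ^ l) →
      ∀ j, 2 * l - i ≤ j → j ≤ 2 * l → ∀ x ∈ Icc (1 / 2 : ℝ) 1,
        |iteratedDeriv j F x| ≤ C * M / wt m x ^ max 1 (j - l) := by
  induction i with
  | zero =>
    refine ⟨1, zero_le_one, fun m hm F hF M hM _ hr j hj hj' x hx => ?_⟩
    obtain rfl : j = 2 * l := by omega
    rw [one_mul, show max 1 (2 * l - l) = l by omega]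
    exact hr x ⟨by linarith [hx.1], hx.2⟩
  | succ i ih =>
    obtain ⟨C, hC, ih⟩ := ih (by omega)
    obtain ⟨K, hK, hL⟩ := exists_abs_iteratedDeriv_mul_le (2 * l) (by omega)
    set C₀ : ℝ := 4 ^ (2 * l) * (K * (1 + (16 / 3) ^ l)) with hC₀
    have hC₀0 : 0 ≤ C₀ := by positivity
    refine ⟨C + (C₀ + 2 * 4 ^ l * C), by positivity, fun m hm F hF M hM h0 hr j hj hj' x hx => ?_⟩
    have hw := wt_pos hm x
    by_cases hji : 2 * l - i ≤ j
    · refine (ih m hm F hF M hM h0 hr j hji hj' x hx).trans ?_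
      gcongr
      have : 0 ≤ C₀ + 2 * 4 ^ l * C := by positivity
      linarith
    have hmid : |iteratedDeriv j F (1 / 2)| ≤ C₀ * M := by
      have h := hL F hF (1 / 2) (1 / 4) M ((16 / 3) ^ l * M)
        (fun y hy => h0 _ ⟨by linarith [hy.1], by linarith [hy.2]⟩)
        (fun y hy => by
          refine (hr _ ⟨by linarith [hy.1], by linarith [hy.2]⟩).trans ?_
          rw [div_le_iff₀ (by have := wt_pos hm (1 / 2 + 1 / 4 * y); positivity)]
          have e : 3 / 16 ≤ wt m (1 / 2 + 1 / 4 * y) :=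
            le_trans (by nlinarith [hy.1, hy.2]) (le_wt m _)
          have e2 : (1 : ℝ) ≤ (16 / 3 * wt m (1 / 2 + 1 / 4 * y)) ^ l := one_le_pow₀ (by linarith)
          rw [mul_pow] at e2
          nlinarith) j (by omega)
      have e1 : |(1 / 4 : ℝ)| = 1 / 4 := abs_of_pos (by norm_num)
      rw [e1] at h
      have e2 : ((1 : ℝ) / 4) ^ (2 * l) ≤ 1 := pow_le_one₀ (by norm_num) (by norm_num)
      have e3 : ((1 : ℝ) / 4) ^ (2 * l) ≤ (1 / 4) ^ j :=
        pow_le_pow_of_le_one (by norm_num) (by norm_num) (by omega)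
      have e4 : (4 : ℝ) ^ (2 * l) * (1 / 4) ^ (2 * l) = 1 := by
        rw [← mul_pow]; norm_num
      have hB : (16 / 3 : ℝ) ^ l * M * (1 / 4) ^ (2 * l) ≤ (16 / 3) ^ l * M :=
        mul_le_of_le_one_right (by positivity) e2
      calc |iteratedDeriv j F (1 / 2)|
          = 4 ^ (2 * l) * (|iteratedDeriv j F (1 / 2)| * (1 / 4) ^ (2 * l)) := by
            linear_combination (-|iteratedDeriv j F (1 / 2)|) * e4
        _ ≤ 4 ^ (2 * l) * (|iteratedDeriv j F (1 / 2)| * (1 / 4) ^ j) := by gcongr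
        _ ≤ 4 ^ (2 * l) * (K * (M + (16 / 3) ^ l * M * (1 / 4) ^ (2 * l))) := by gcongr
        _ ≤ 4 ^ (2 * l) * (K * (M + (16 / 3) ^ l * M)) := by gcongr
        _ = _ := by rw [hC₀]; ring
    set e := max 1 (j - l) with he
    have hm0 : 0 < 1 / (m : ℝ) := by positivity
    have hm1 := inv_natCast_le_one hm
    have hq : ∀ v ∈ Icc (1 / 2 : ℝ) 1, 0 < 1 - v + 1 / (m : ℝ) ∧ 1 - v + 1 / (m : ℝ) ≤ 2 :=
      fun v hv => ⟨by linarith [hv.2], by linarith [hv.1]⟩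
    set B : ℝ → ℝ := fun v => C₀ * M + 2 * 4 ^ l * C * M * ((1 - v + 1 / (m : ℝ)) ^ e)⁻¹ with hB
    have hBd : ∀ v ∈ Icc (1 / 2 : ℝ) 1, HasDerivAt B
        (2 * 4 ^ l * C * M * (e / (1 - v + 1 / (m : ℝ)) ^ (e + 1))) v := by
      intro v hv
      have h1 : HasDerivAt (fun v => 1 - v + 1 / (m : ℝ)) (-1) v := by
        simpa using ((hasDerivAt_id v).const_sub 1).add_const (1 / (m : ℝ))
      have hp := (hq v hv).1
      have h2 := (((h1.fun_pow e).fun_inv (by positivity)).const_mul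
        (2 * 4 ^ l * C * M)).const_add (C₀ * M)
      refine h2.congr_deriv ?_
      clear_value e
      generalize 1 - v + 1 / (m : ℝ) = q at hp
      have he1 : 1 ≤ e := by omega
      obtain ⟨n, hn⟩ := Nat.exists_eq_add_of_le' he1
      rw [hn]
      simp only [Nat.add_sub_cancel]
      field_simp
      ring
    have hmain := image_norm_le_of_norm_deriv_right_le_deriv_boundary' (a := 1 / 2) (b := 1)
      (f := iteratedDeriv j F) (f' := iteratedDeriv (j + 1) F)
      (B := B) (B' := fun v => 2 * 4 ^ l * C * M * (e / (1 - v + 1 / (m : ℝ)) ^ (e + 1)))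
      (fun v _ => (hasDerivAt_iteratedDeriv hF (by omega) v).continuousAt.continuousWithinAt)
      (fun v _ => (hasDerivAt_iteratedDeriv hF (by omega) v).hasDerivWithinAt)
      (by
        rw [Real.norm_eq_abs]
        refine hmid.trans ?_
        have := (hq (1 / 2) (by norm_num)).1
        exact le_add_of_nonneg_right (by positivity))
      (fun v hv => (hBd v hv).continuousAt.continuousWithinAt)
      (fun v hv => (hBd v (Ico_subset_Icc_self hv)).hasDerivWithinAt)
      (fun v hv => by
        have hv' := Ico_subset_Icc_self hv
        obtain ⟨q0, q2⟩ := hq v hv'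
        set q := 1 - v + 1 / (m : ℝ)
        have hwv := wt_pos hm v
        have hwb := (wt_bounds_right m hv').1
        rw [Real.norm_eq_abs]
        refine (ih m hm F hF M hM h0 hr (j + 1) (by omega) (by omega) v hv').trans ?_
        set a := max 1 (j + 1 - l) with ha
        have hal : a ≤ l := by omega
        have h1 : q ^ a ≤ 4 ^ l * wt m v ^ a := by
          calc q ^ a ≤ (4 * wt m v) ^ a := pow_le_pow_left₀ q0.le (by linarith) a
            _ = 4 ^ a * wt m v ^ a := mul_pow _ _ _
            _ ≤ _ := by gcongr; norm_num
        have h2 : q ^ (e + 1) ≤ 2 * q ^ a := by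
          rcases (show e + 1 = a ∨ e + 1 = a + 1 by omega) with h | h <;> rw [h]
          · nlinarith [pow_pos q0 a]
          · rw [pow_succ]; nlinarith [pow_pos q0 a]
        have he1 : (1 : ℝ) ≤ e := by exact_mod_cast (le_max_left 1 (j - l))
        have h3 : C * M / wt m v ^ a ≤ 4 ^ l * C * M / q ^ a := by
          rw [div_le_div_iff₀ (by positivity) (by positivity)]
          have := mul_le_mul_of_nonneg_left h1 (mul_nonneg hC hM)
          linarith
        refine h3.trans ?_
        have h4 : 1 / q ^ a ≤ 2 * (e / q ^ (e + 1)) := by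
          rw [mul_div_assoc', div_le_div_iff₀ (by positivity) (by positivity)]
          nlinarith [pow_pos q0 a]
        have := mul_le_mul_of_nonneg_left h4 (by positivity : 0 ≤ 4 ^ l * C * M)
        calc 4 ^ l * C * M / q ^ a = 4 ^ l * C * M * (1 / q ^ a) := by ring
          _ ≤ _ := this
          _ = _ := by ring) hx
    rw [Real.norm_eq_abs] at hmain
    refine hmain.trans ?_
    have hwq := (wt_bounds_right m hx).2
    have hq0 := (hq x hx).1
    have hw1 : wt m x ^ e ≤ 1 := pow_le_one₀ hw.le (wt_le_one hm x)
    have h1 : C₀ * M ≤ C₀ * M / wt m x ^ e := by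
      rw [le_div_iff₀ (by positivity)]
      exact mul_le_of_le_one_right (by positivity) hw1
    have h2 : 2 * 4 ^ l * C * M * ((1 - x + 1 / (m : ℝ)) ^ e)⁻¹ ≤
        2 * 4 ^ l * C * M / wt m x ^ e := by
      rw [div_eq_mul_inv]
      refine mul_le_mul_of_nonneg_left ?_ (by positivity)
      exact inv_anti₀ (by positivity) (pow_le_pow_left₀ hw.le hwq e)
    calc B x ≤ C₀ * M / wt m x ^ e + 2 * 4 ^ l * C * M / wt m x ^ e := add_le_add h1 h2
      _ = (C₀ + 2 * 4 ^ l * C) * M / wt m x ^ e := by ring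
      _ ≤ _ := div_le_div_of_nonneg_right
          (mul_le_mul_of_nonneg_right (by linarith) hM) (by positivity)

/-- Weighted bounds on the intermediate derivatives, by integrating from the midpoint. -/
lemma exists_abs_iteratedDeriv_le (l : ℕ) (hl : 1 ≤ l) : ∃ C : ℝ, 1 ≤ C ∧
    ∀ m : ℕ, 1 ≤ m → ∀ F : ℝ → ℝ, ContDiff ℝ (2 * l : ℕ) F → ∀ M : ℝ, 0 ≤ M →
      (∀ x ∈ Icc (0 : ℝ) 1, |F x| ≤ M) →
      (∀ x ∈ Icc (0 : ℝ) 1, |iteratedDeriv (2 * l) F x| ≤ M / wt m x ^ l) →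
      ∀ j ≤ 2 * l, ∀ x ∈ Icc (0 : ℝ) 1,
        |iteratedDeriv j F x| ≤ C * M / wt m x ^ max 1 (j - l) := by
  obtain ⟨C, hC, h⟩ := exists_abs_iteratedDeriv_le_right l hl (2 * l) le_rfl
  refine ⟨C + 1, by linarith, fun m hm F hF M hM h0 hr j hj x hx => ?_⟩
  have hw := wt_pos hm x
  suffices hs : |iteratedDeriv j F x| ≤ C * M / wt m x ^ max 1 (j - l) from
    hs.trans (by gcongr; linarith)
  rcases le_total (1 / 2) x with hx2 | hx2
  · exact h m hm F hF M hM h0 hr j (by omega) hj x ⟨hx2, hx.2⟩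
  · have hrf : ∀ i ≤ 2 * l, ∀ y, |iteratedDeriv i (fun y => F (1 + -1 * y)) y| =
        |iteratedDeriv i F (1 + -1 * y)| := by
      intro i hi y
      rw [iteratedDeriv_comp_add_mul (hF.of_le (by exact_mod_cast hi)), abs_mul, abs_pow]
      simp
    have hmem : ∀ y ∈ Icc (0 : ℝ) 1, 1 + -1 * y ∈ Icc (0 : ℝ) 1 :=
      fun y hy => ⟨by linarith [hy.2], by linarith [hy.1]⟩
    have := h m hm (fun y => F (1 + -1 * y))
      (hF.comp (contDiff_const.add (contDiff_const.mul contDiff_id))) M hM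
      (fun y hy => h0 _ (hmem y hy))
      (fun y hy => by rw [hrf _ le_rfl, ← wt_reflect]; exact hr _ (hmem y hy))
      j (by omega) hj (1 + -1 * x) ⟨by linarith, by linarith [hx.1]⟩
    rw [hrf j hj, wt_reflect] at this
    convert this using 3
    ring

/-- Intermediate derivatives at the scale given by the weight. -/
lemma exists_abs_iteratedDeriv_mul_sqrt_le (l : ℕ) (hl : 1 ≤ l) : ∃ C : ℝ, 0 ≤ C ∧
    ∀ m : ℕ, 1 ≤ m → ∀ ρ ∈ Ioc (0 : ℝ) 1, ∀ F : ℝ → ℝ, ContDiff ℝ (2 * l : ℕ) F → ∀ A : ℝ,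
      (∀ x ∈ Icc (0 : ℝ) 1, |F x| ≤ A) →
      (∀ x ∈ Icc (0 : ℝ) 1, |iteratedDeriv (2 * l) F x| ≤ A / (ρ * wt m x) ^ l) →
      ∀ i ≤ 2 * l, ∀ x ∈ Icc (0 : ℝ) 1,
        |iteratedDeriv i F x| * √(ρ * wt m x) ^ i ≤ C * A := by
  obtain ⟨K, hK, hL⟩ := exists_abs_iteratedDeriv_mul_le (2 * l) (by omega)
  refine ⟨4 ^ (2 * l) * (K * (1 + 2 ^ l)), by positivity, fun m hm ρ hρ F hF A h0 hr i hi x hx => ?_⟩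
  have hA : 0 ≤ A := (abs_nonneg _).trans (h0 x hx)
  have hw := wt_pos hm x
  have hw1 := wt_le_one hm x
  have hρ0 := hρ.1
  set s := √(ρ * wt m x) with hs
  have hs0 : 0 < s := Real.sqrt_pos.mpr (by positivity)
  have hs1 : s ≤ 1 := Real.sqrt_le_one.mpr (mul_le_one₀ hρ.2 hw.le hw1)
  have hss : s ^ 2 = ρ * wt m x := Real.sq_sqrt (by positivity)
  obtain ⟨u, hu, d, hd, hdu, hdu'⟩ : ∃ u ∈ Icc (0 : ℝ) 1, ∃ d, |d| = s / 4 ∧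
      0 ≤ d / (u - x) ∧ d / (u - x) ≤ 1 / 2 ∧ u - x ≠ 0 := by
    rcases le_total x (1 / 2) with h | h
    · refine ⟨1, by simp, s / 4, abs_of_pos (by positivity), ?_, ?_, ?_⟩
      · exact div_nonneg (by positivity) (by linarith)
      · rw [div_le_iff₀ (by linarith)]; linarith
      · linarith
    · refine ⟨0, by simp, -(s / 4), ?_, ?_, ?_, ?_⟩
      · rw [abs_neg]; exact abs_of_pos (by positivity)
      · exact div_nonneg_of_nonpos (by linarith) (by linarith)
      · rw [div_le_iff_of_neg (by linarith)]; linarith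
      · linarith
  have hpt : ∀ y ∈ Icc (0 : ℝ) 1, x + d * y ∈ Icc (0 : ℝ) 1 ∧ wt m x / 2 ≤ wt m (x + d * y) := by
    intro y hy
    have e : x + d * y = x + (u - x) * (d / (u - x) * y) := by
      have := hdu'.2
      field_simp
    have h1 : 0 ≤ d / (u - x) * y := mul_nonneg hdu hy.1
    have h2 : d / (u - x) * y ≤ 1 / 2 := by nlinarith [hy.1, hy.2, hdu'.1]
    rw [e]
    refine ⟨?_, ?_⟩
    · constructor <;> nlinarith [hx.1, hx.2, hu.1, hu.2]
    · refine le_trans ?_ (wt_segment hu ⟨h1, by linarith⟩)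
      nlinarith
  have h := hL F hF x d A (2 ^ l * A / (ρ * wt m x) ^ l) (fun y hy => h0 _ (hpt y hy).1)
    (fun y hy => by
      obtain ⟨hp, hpw⟩ := hpt y hy
      refine (hr _ hp).trans ?_
      have hwp := wt_pos hm (x + d * y)
      rw [div_le_div_iff₀ (by positivity) (by positivity)]
      have : (ρ * wt m x) ^ l ≤ 2 ^ l * (ρ * wt m (x + d * y)) ^ l := by
        rw [← mul_pow]
        refine pow_le_pow_left₀ (by positivity) ?_ l
        nlinarith
      nlinarith) i hi
  rw [hd] at h
  have e1 : 2 ^ l * A / (ρ * wt m x) ^ l * (s / 4) ^ (2 * l) ≤ 2 ^ l * A := by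
    rw [pow_mul, div_pow, hss, div_pow]
    have h1 : (1 : ℝ) ≤ (4 ^ 2) ^ l := one_le_pow₀ (by norm_num)
    have hq : (ρ * wt m x) ^ l ≠ 0 := by positivity
    have : 2 ^ l * A / (ρ * wt m x) ^ l * ((ρ * wt m x) ^ l / (4 ^ 2) ^ l) =
        2 ^ l * A / (4 ^ 2) ^ l := by field_simp
    rw [this]
    exact div_le_self (by positivity) h1
  have e2 : (4 : ℝ) ^ i ≤ 4 ^ (2 * l) := pow_le_pow_right₀ (by norm_num) hi
  calc |iteratedDeriv i F x| * s ^ i = 4 ^ i * (|iteratedDeriv i F x| * (s / 4) ^ i) := by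
        rw [div_pow]; field_simp
    _ ≤ 4 ^ (2 * l) * (K * (A + 2 ^ l * A)) := by
        refine mul_le_mul e2 (h.trans ?_) (by positivity) (by positivity)
        gcongr
    _ = _ := by ring

lemma exists_abs_iteratedDeriv_mul_fun_le (l : ℕ) (hl : 1 ≤ l) : ∃ C : ℝ, 1 ≤ C ∧
    ∀ m : ℕ, 1 ≤ m → ∀ ρ ∈ Ioc (0 : ℝ) 1, ∀ F G : ℝ → ℝ, ContDiff ℝ (2 * l : ℕ) F →
      ContDiff ℝ (2 * l : ℕ) G → ∀ A B : ℝ,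
      (∀ x ∈ Icc (0 : ℝ) 1, |F x| ≤ A) →
      (∀ x ∈ Icc (0 : ℝ) 1, |iteratedDeriv (2 * l) F x| ≤ A / (ρ * wt m x) ^ l) →
      (∀ x ∈ Icc (0 : ℝ) 1, |G x| ≤ B) →
      (∀ x ∈ Icc (0 : ℝ) 1, |iteratedDeriv (2 * l) G x| ≤ B / (ρ * wt m x) ^ l) →
      ∀ x ∈ Icc (0 : ℝ) 1,
        |iteratedDeriv (2 * l) (fun y => F y * G y) x| ≤ C * (A * B) / (ρ * wt m x) ^ l := by
  obtain ⟨C, hC, h⟩ := exists_abs_iteratedDeriv_mul_sqrt_le l hl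
  refine ⟨2 ^ (2 * l) * C ^ 2 + 1, by nlinarith [show 0 ≤ 2 ^ (2 * l) * C ^ 2 by positivity],
    fun m hm ρ hρ F G hF hG A B hF0 hFr hG0 hGr x hx => ?_⟩
  have hA : 0 ≤ A := (abs_nonneg _).trans (hF0 x hx)
  have hB : 0 ≤ B := (abs_nonneg _).trans (hG0 x hx)
  have hw := wt_pos hm x
  have hρ0 := hρ.1
  have hpow : (ρ * wt m x) ^ l = √(ρ * wt m x) ^ (2 * l) := by
    rw [pow_mul, Real.sq_sqrt (by positivity)]
  set s := √(ρ * wt m x) with hs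
  have hs0 : 0 < s := Real.sqrt_pos.mpr (by positivity)
  rw [hpow, le_div_iff₀ (by positivity), iteratedDeriv_fun_mul hF.contDiffAt hG.contDiffAt]
  refine (mul_le_mul_of_nonneg_right (Finset.abs_sum_le_sum_abs _ _) (by positivity)).trans ?_
  rw [Finset.sum_mul]
  have hterm : ∀ i ∈ Finset.range (2 * l + 1), |((2 * l).choose i : ℝ) * iteratedDeriv i F x *
      iteratedDeriv (2 * l - i) G x| * s ^ (2 * l) ≤ (2 * l).choose i * (C ^ 2 * (A * B)) := by
    intro i hi
    have hi' : i ≤ 2 * l := by have := Finset.mem_range.mp hi; omega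
    have h1 := h m hm ρ hρ F hF A hF0 hFr i hi' x hx
    have h2 := h m hm ρ hρ G hG B hG0 hGr (2 * l - i) (by omega) x hx
    have e : s ^ (2 * l) = s ^ i * s ^ (2 * l - i) := by rw [← pow_add]; congr 1; omega
    rw [abs_mul, abs_mul, Nat.abs_cast, e]
    have h3 := mul_le_mul h1 h2 (by positivity) (by positivity)
    calc _ = ((2 * l).choose i : ℝ) * (|iteratedDeriv i F x| * s ^ i *
          (|iteratedDeriv (2 * l - i) G x| * s ^ (2 * l - i))) := by ring
      _ ≤ ((2 * l).choose i : ℝ) * (C * A * (C * B)) := by gcongr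
      _ = _ := by ring
  refine (Finset.sum_le_sum hterm).trans ?_
  rw [← Finset.sum_mul]
  have : ∑ i ∈ Finset.range (2 * l + 1), ((2 * l).choose i : ℝ) = 2 ^ (2 * l) := by
    exact_mod_cast Nat.sum_range_choose (2 * l)
  rw [this]
  nlinarith [mul_nonneg hA hB]

/-- Steklov mean with step `c`. -/
noncomputable def steklov (c : ℝ) (f : ℝ → ℝ) (x : ℝ) : ℝ := ∫ u in (0 : ℝ)..1, f (x + c * u)

lemma continuous_steklov_iterate (c : ℝ) {f : ℝ → ℝ} (hf : Continuous f) (n : ℕ) :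
    Continuous ((steklov c)^[n] f) := by
  induction n with
  | zero => simpa
  | succ n ih =>
    rw [Function.iterate_succ_apply']
    exact intervalIntegral.continuous_parametric_intervalIntegral_of_continuous'
      (f := fun x u => (steklov c)^[n] f (x + c * u)) (ih.comp (by fun_prop)) 0 1

lemma hasDerivAt_steklov {c : ℝ} (hc : c ≠ 0) {f : ℝ → ℝ} (hf : Continuous f) (x : ℝ) :
    HasDerivAt (steklov c f) (c⁻¹ * (f (x + c) - f x)) x := by
  have e : steklov c f = fun x => c⁻¹ * ((∫ v in (0 : ℝ)..(x + c), f v) - ∫ v in (0 : ℝ)..x, f v) := by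
    funext x
    unfold steklov
    rw [intervalIntegral.integral_comp_add_mul _ hc, smul_eq_mul, mul_zero, mul_one, add_zero,
      intervalIntegral.integral_interval_sub_left (hf.intervalIntegrable _ _)
      (hf.intervalIntegrable _ _)]
  rw [e]
  have h1 : ∀ y, HasDerivAt (fun x => ∫ v in (0 : ℝ)..x, f v) (f y) y := fun y =>
    intervalIntegral.integral_hasDerivAt_right (hf.intervalIntegrable _ _)
      (hf.stronglyMeasurableAtFilter volume _) hf.continuousAt
  exact (((h1 (x + c)).comp_add_const x c).sub (h1 x)).const_mul _

lemma contDiff_steklov_iterate {c : ℝ} (hc : c ≠ 0) {f : ℝ → ℝ} (hf : Continuous f) (n : ℕ) :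
    ContDiff ℝ n ((steklov c)^[n] f) := by
  induction n with
  | zero => exact contDiff_zero.mpr hf
  | succ n ih =>
    rw [Function.iterate_succ_apply']
    have hd := hasDerivAt_steklov hc (continuous_steklov_iterate c hf n)
    rw [show ((n + 1 : ℕ) : WithTop ℕ∞) = (n : WithTop ℕ∞) + 1 by norm_cast, contDiff_succ_iff_deriv]
    refine ⟨fun x => (hd x).differentiableAt, by simp, ?_⟩
    rw [funext fun x => (hd x).deriv]
    exact contDiff_const.mul ((ih.comp (contDiff_id.add contDiff_const)).sub ih)

lemma iteratedDeriv_steklov_iterate {c : ℝ} (hc : c ≠ 0) {f : ℝ → ℝ} (hf : Continuous f) (n : ℕ) :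
    iteratedDeriv n ((steklov c)^[n] f) = fun x => c⁻¹ ^ n * (fwdDiff c)^[n] f x := by
  induction n with
  | zero => simp
  | succ n ih =>
    have hd := hasDerivAt_steklov hc (continuous_steklov_iterate c hf n)
    have hC := contDiff_steklov_iterate hc hf n
    rw [iteratedDeriv_succ', Function.iterate_succ_apply', funext fun x => (hd x).deriv]
    funext x
    have h1 : ContDiff ℝ n (fun x => (steklov c)^[n] f (x + c)) :=
      hC.comp (contDiff_id.add contDiff_const)
    rw [iteratedDeriv_const_mul_field, iteratedDeriv_fun_sub h1.contDiffAt hC.contDiffAt,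
      iteratedDeriv_comp_add_const, ih, Function.iterate_succ_apply', fwdDiff]
    ring

lemma steklov_iterate_comp (c : ℝ) (f : ℝ → ℝ) (x : ℝ) (n : ℕ) (y : ℝ) :
    (steklov c)^[n] f (x + c * y) = (steklov 1)^[n] (fun y => f (x + c * y)) y := by
  induction n generalizing y with
  | zero => rfl
  | succ n ih =>
    rw [Function.iterate_succ_apply', Function.iterate_succ_apply']
    refine intervalIntegral.integral_congr fun u _ => ?_
    rw [← ih, one_mul, mul_add, add_assoc]

lemma abs_steklov_one_iterate_le {G : ℝ → ℝ} {ε : ℝ} (n : ℕ) (y : ℝ)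
    (h : ∀ z ∈ Icc y (y + n), |G z| ≤ ε) : |(steklov 1)^[n] G y| ≤ ε := by
  induction n generalizing y with
  | zero => exact h y (by simp)
  | succ n ih =>
    rw [Function.iterate_succ_apply']
    have := intervalIntegral.norm_integral_le_of_norm_le_const (a := (0 : ℝ)) (b := 1) (C := ε)
      (f := fun u => (steklov 1)^[n] G (y + 1 * u))
      (fun u hu => ih _ fun z hz => h z (by
        rw [uIoc_of_le zero_le_one] at hu
        have := hu.1
        have := hu.2
        push_cast
        constructor <;> linarith [hz.1, hz.2]))
    rw [sub_zero, abs_one, mul_one] at this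
    exact this

lemma steklov_one_iterate_sum {ι : Type*} (S : Finset ι) (a : ι → ℝ) (G : ι → ℝ → ℝ)
    (hG : ∀ i, Continuous (G i)) (n : ℕ) (y : ℝ) :
    (steklov 1)^[n] (fun y => ∑ i ∈ S, a i * G i y) y = ∑ i ∈ S, a i * (steklov 1)^[n] (G i) y := by
  induction n generalizing y with
  | zero => rfl
  | succ n ih =>
    simp only [Function.iterate_succ_apply']
    rw [show (steklov 1)^[n] (fun y => ∑ i ∈ S, a i * G i y) =
      fun y => ∑ i ∈ S, a i * (steklov 1)^[n] (G i) y from funext ih]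
    have hc : ∀ i ∈ S, IntervalIntegrable (fun u => a i * (steklov 1)^[n] (G i) (y + 1 * u))
        volume 0 1 := fun i _ => (continuous_const.mul
      ((continuous_steklov_iterate 1 (hG i) n).comp (by fun_prop))).intervalIntegrable _ _
    exact (intervalIntegral.integral_finsetSum hc).trans
      (Finset.sum_congr rfl fun i _ => intervalIntegral.integral_const_mul _ _)

/-- A smooth function whose distance to `f` and whose `r`-th derivative are controlled by the
`r`-th differences of `f` with step at most `r * |s|`. -/
lemma exists_contDiff_abs_sub_le (r : ℕ) {f : ℝ → ℝ} (hf : Continuous f) {s : ℝ}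
    (hs : s ≠ 0) : ∃ g : ℝ → ℝ, ContDiff ℝ r g ∧ ∀ x ε : ℝ,
      (∀ y ∈ Icc (0 : ℝ) r, |∑ k ∈ Finset.range (r + 1),
        (-1 : ℝ) ^ k * (r.choose k : ℝ) * f (x + k * (s * y))| ≤ ε) →
      |f x - g x| ≤ ε ∧ |iteratedDeriv r g x| ≤ 2 ^ r * ε / |s| ^ r := by
  set a : ℕ → ℝ := fun k => (-1 : ℝ) ^ k * (r.choose k : ℝ) with ha
  set g : ℝ → ℝ := fun x => ∑ k ∈ Finset.Icc 1 r, -a k * (steklov (k * s))^[r] f x with hg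
  have hks : ∀ k ∈ Finset.Icc 1 r, (k : ℝ) * s ≠ 0 := fun k hk => by
    have := (Finset.mem_Icc.mp hk).1
    have hk0 : (k : ℝ) ≠ 0 := by positivity
    exact mul_ne_zero hk0 hs
  have hcd : ∀ k ∈ Finset.Icc 1 r, ContDiff ℝ r (fun x => -a k * (steklov (k * s))^[r] f x) :=
    fun k hk => contDiff_const.mul (contDiff_steklov_iterate (hks k hk) hf r)
  refine ⟨g, ContDiff.sum hcd, fun x ε hε => ⟨?_, ?_⟩⟩
  · have h := abs_steklov_one_iterate_le (G := fun y => ∑ k ∈ Finset.range (r + 1),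
      a k * f (x + k * (s * y))) (ε := ε) r 0 (fun z hz => hε z (by simpa using hz))
    rw [steklov_one_iterate_sum (G := fun (k : ℕ) y => f (x + k * (s * y)))
      (hG := fun k => hf.comp (by fun_prop))] at h
    have e : ∀ k : ℕ, (steklov 1)^[r] (fun y => f (x + k * (s * y))) 0 =
        (steklov (k * s))^[r] f x := by
      intro k
      have := steklov_iterate_comp (k * s) f x r 0
      rw [mul_zero, add_zero] at this
      rw [this]
      simp only [mul_assoc]
    simp only [e] at h
    have e0 : (steklov ((0 : ℕ) * s))^[r] f x = f x := by
      have hst : steklov ((0 : ℕ) * s) f = f := by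
        funext x
        simp [steklov]
      rw [Function.iterate_fixed hst]
    rw [Finset.range_eq_Ico, Finset.sum_eq_sum_Ico_succ_bot (by omega), e0] at h
    have e1 : f x - g x = a 0 * f x +
        ∑ k ∈ Finset.Ico (0 + 1) (r + 1), a k * (steklov (k * s))^[r] f x := by
      have : Finset.Ico (0 + 1) (r + 1) = Finset.Icc 1 r := by ext; simp
      rw [this]
      simp [hg, ha, sub_eq_add_neg]
    rw [e1]
    exact h
  · have e : iteratedDeriv r g x = ∑ k ∈ Finset.Icc 1 r,
        -a k * ((k * s)⁻¹ ^ r * (fwdDiff (k * s))^[r] f x) := by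
      rw [hg, iteratedDeriv_fun_sum fun k hk => (hcd k hk).contDiffAt]
      refine Finset.sum_congr rfl fun k hk => ?_
      rw [iteratedDeriv_const_mul_field, iteratedDeriv_steklov_iterate (hks k hk) hf]
    have hs0 : 0 < |s| := abs_pos.mpr hs
    have hε0 : 0 ≤ ε := (abs_nonneg _).trans (hε 0 (by simp))
    rw [e]
    refine (Finset.abs_sum_le_sum_abs _ _).trans ?_
    have hterm : ∀ k ∈ Finset.Icc 1 r,
        |-a k * ((k * s)⁻¹ ^ r * (fwdDiff (k * s))^[r] f x)| ≤ r.choose k * (ε / |s| ^ r) := by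
      intro k hk
      have hk' := Finset.mem_Icc.mp hk
      have hk1 : (1 : ℝ) ≤ k := by exact_mod_cast hk'.1
      have h1 : |(fwdDiff (k * s))^[r] f x| ≤ ε := by
        have h := hε k ⟨by positivity, by exact_mod_cast hk'.2⟩
        rw [fwdDiff_iter_eq_sum_shift]
        have e2 : ∑ j ∈ Finset.range (r + 1), ((-1 : ℤ) ^ (r - j) * r.choose j) • f (x + j • (k * s)) =
            (-1) ^ r * ∑ j ∈ Finset.range (r + 1),
              (-1 : ℝ) ^ j * (r.choose j : ℝ) * f (x + j * (s * k)) := by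
          rw [Finset.mul_sum]
          refine Finset.sum_congr rfl fun j hj => ?_
          have hj' : j ≤ r := by have := Finset.mem_range.mp hj; omega
          have e3 : (-1 : ℝ) ^ r * (-1) ^ j = (-1) ^ (r - j) := by
            obtain ⟨i, rfl⟩ := Nat.exists_eq_add_of_le hj'
            rw [Nat.add_sub_cancel_left, pow_add, mul_right_comm, ← mul_pow]
            simp
          rw [zsmul_eq_mul, nsmul_eq_mul, ← mul_assoc ((-1 : ℝ) ^ r), ← mul_assoc ((-1 : ℝ) ^ r), e3,
            mul_comm s]
          push_cast
          rfl
        rw [e2, abs_mul, abs_pow]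
        simpa using h
      have h2 : |(k * s)⁻¹ ^ r| ≤ 1 / |s| ^ r := by
        rw [abs_pow, abs_inv, abs_mul, Nat.abs_cast, one_div, ← inv_pow]
        refine pow_le_pow_left₀ (by positivity) (inv_anti₀ hs0 ?_) r
        nlinarith
      have h3 : |-a k| = r.choose k := by simp [ha, abs_mul]
      rw [abs_mul, abs_mul, h3]
      refine mul_le_mul_of_nonneg_left ?_ (by positivity)
      calc _ ≤ 1 / |s| ^ r * ε := mul_le_mul h2 h1 (abs_nonneg _) (by positivity)
        _ = _ := by ring
    refine (Finset.sum_le_sum hterm).trans ?_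
    rw [← Finset.sum_mul, mul_div_assoc]
    refine mul_le_mul_of_nonneg_right ?_ (by positivity)
    have : (2 : ℝ) ^ r = ∑ k ∈ Finset.range (r + 1), (r.choose k : ℝ) := by
      exact_mod_cast (Nat.sum_range_choose r).symm
    rw [this]
    refine Finset.sum_le_sum_of_subset_of_nonneg (fun k hk => ?_) (fun _ _ _ => by positivity)
    have := Finset.mem_Icc.mp hk
    simp; omega

lemma exists_abs_le_of_continuousOn {f : ℝ → ℝ} (hf : ContinuousOn f (Icc 0 1)) :
    ∃ B, ∀ x ∈ Icc (0 : ℝ) 1, |f x| ≤ B := by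
  obtain ⟨B, hB⟩ := isCompact_Icc.exists_bound_of_continuousOn hf
  exact ⟨B, hB⟩

lemma sSup_zygSet_nonneg (lam : ℝ) (r : ℕ) (f : ℝ → ℝ) : 0 ≤ sSup (zygSet lam r f) := by
  refine Real.sSup_nonneg ?_
  rintro y ⟨t, ht, rfl⟩
  refine div_nonneg (Real.sSup_nonneg ?_) (by positivity)
  rintro y ⟨h, x, -, -, -, rfl⟩
  exact abs_nonneg _

lemma abs_le_Znorm {lam : ℝ} {r : ℕ} {f : ℝ → ℝ} (hf : memZ lam r f) {x : ℝ}
    (hx : x ∈ Icc (0 : ℝ) 1) : |f x| ≤ Znorm lam r f := by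
  obtain ⟨B, hB⟩ := exists_abs_le_of_continuousOn hf.1
  have h : |f x| ≤ supNorm f :=
    le_ciSup (f := fun x : Icc (0 : ℝ) 1 => |f x|) ⟨B, by rintro _ ⟨y, rfl⟩; exact hB y y.2⟩ ⟨x, hx⟩
  unfold Znorm
  linarith [sSup_zygSet_nonneg lam r f]

lemma Znorm_nonneg {lam : ℝ} {r : ℕ} {f : ℝ → ℝ} (hf : memZ lam r f) : 0 ≤ Znorm lam r f :=
  (abs_nonneg _).trans (abs_le_Znorm hf (x := 0) (by simp))

lemma abs_dtDiff_le {lam : ℝ} {r : ℕ} {f : ℝ → ℝ} (hf : memZ lam r f) {h x : ℝ} (hh : 0 < h)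
    (hx : dtAdmissible r h x) : |dtDiff r h f x| ≤ Znorm lam r f * h ^ lam := by
  obtain ⟨B, hB⟩ := exists_abs_le_of_continuousOn hf.1
  have h1 : |dtDiff r h f x| ≤ omegaDT r f h := by
    refine le_csSup ⟨∑ k ∈ Finset.range (r + 1), (r.choose k : ℝ) * B, ?_⟩
      ⟨h, x, hh, le_rfl, hx, rfl⟩
    rintro y ⟨h', x', -, -, hx', rfl⟩
    refine (Finset.abs_sum_le_sum_abs _ _).trans (Finset.sum_le_sum fun k hk => ?_)
    rw [abs_mul, abs_mul, abs_pow, abs_neg, abs_one, one_pow, one_mul, Nat.abs_cast]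
    exact mul_le_mul_of_nonneg_left (hB _ (hx'.2 k (by have := Finset.mem_range.mp hk; omega)))
      (by positivity)
  have h2 : omegaDT r f h / h ^ lam ≤ sSup (zygSet lam r f) := le_csSup hf.2 ⟨h, hh, rfl⟩
  have h3 : 0 ≤ supNorm f := Real.iSup_nonneg fun _ => abs_nonneg _
  rw [div_le_iff₀ (by positivity)] at h2
  refine h1.trans (h2.trans (mul_le_mul_of_nonneg_right ?_ (by positivity)))
  unfold Znorm
  linarith

/-- One-sided differences of even order are bounded through the Ditzian–Totik differences. -/
lemma abs_sum_shift_le {lam : ℝ} {l : ℕ} {f : ℝ → ℝ} (hf : memZ lam (2 * l) f) {x s : ℝ}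
    (hs : s ≠ 0) (hx : x ∈ Icc (0 : ℝ) 1) (hxs : x + 2 * l * s ∈ Icc (0 : ℝ) 1)
    (hφ : 0 < (x + l * s) * (1 - (x + l * s))) :
    |∑ k ∈ Finset.range (2 * l + 1), (-1 : ℝ) ^ k * ((2 * l).choose k : ℝ) * f (x + k * s)| ≤
      Znorm lam (2 * l) f * (|s| / √((x + l * s) * (1 - (x + l * s)))) ^ lam := by
  set z := x + l * s with hz
  set p := √(z * (1 - z)) with hp
  have hp0 : 0 < p := Real.sqrt_pos.mpr hφ
  have hφz : phiDT z = p := rfl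
  have hs0 := abs_pos.mpr hs
  have hmem : ∀ k : ℕ, k ≤ 2 * l → x + k * s ∈ Icc (0 : ℝ) 1 := by
    intro k hk
    have hk' : (k : ℝ) ≤ 2 * l := by exact_mod_cast hk
    have hk0 : (0 : ℝ) ≤ k := by positivity
    rcases hs.lt_or_gt with h | h
    · exact ⟨by nlinarith [hxs.1], by nlinarith [hx.2]⟩
    · exact ⟨by nlinarith [hx.1], by nlinarith [hxs.2]⟩
  have hpt : ∀ k : ℕ, z + (((2 * l : ℕ) : ℝ) - 2 * k) * (|s| / p / 2) * phiDT z =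
      z + (l - k) * |s| := by
    intro k
    rw [hφz]
    push_cast
    field_simp
  have hcase : (∀ k : ℕ, z + (l - k) * |s| = x + k * s) ∨
      (∀ k : ℕ, z + (l - k) * |s| = x + (2 * l - k) * s) := by
    rcases hs.lt_or_gt with h | h
    · left; intro k; rw [abs_of_neg h, hz]; ring
    · right; intro k; rw [abs_of_pos h, hz]; ring
  have hadm : dtAdmissible (2 * l) (|s| / p) z := by
    refine ⟨hmem l (by omega), fun k hk => ?_⟩
    rw [hpt]
    rcases hcase with h | h <;> rw [h]
    · exact hmem k hk
    · have := hmem (2 * l - k) (by omega)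
      rwa [Nat.cast_sub hk, Nat.cast_mul, Nat.cast_ofNat] at this
  have hdiff : dtDiff (2 * l) (|s| / p) f z =
      ∑ k ∈ Finset.range (2 * l + 1), (-1 : ℝ) ^ k * ((2 * l).choose k : ℝ) * f (x + k * s) := by
    unfold dtDiff
    rcases hcase with h | h
    · exact Finset.sum_congr rfl fun k _ => by rw [hpt, h]
    · rw [← Finset.sum_range_reflect]
      refine Finset.sum_congr rfl fun k hk => ?_
      have hk' : k ≤ 2 * l := by have := Finset.mem_range.mp hk; omega
      rw [hpt, h, show 2 * l + 1 - 1 - k = 2 * l - k by omega, Nat.choose_symm hk',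
        Nat.cast_sub hk']
      have e : (-1 : ℝ) ^ (2 * l - k) = (-1) ^ k :=
        neg_one_pow_congr (by simp [Nat.even_sub hk'])
      rw [e]
      push_cast
      congr 2
      ring
  rw [← hdiff]
  exact abs_dtDiff_le hf (by positivity) hadm

lemma abs_sum_shift_le_of_sq_le {lam : ℝ} (hlam : 0 < lam) {l : ℕ} (hl : 1 ≤ l) {f : ℝ → ℝ}
    (hf : memZ lam (2 * l) f) {m : ℕ} (hm : 1 ≤ m) {x s : ℝ} (hx : x ∈ Icc (0 : ℝ) 1)
    (hsx : 0 ≤ s ∧ x ≤ 5 / 8 ∨ s ≤ 0 ∧ 3 / 8 ≤ x) (hs : 2 * l * |s| ≤ 1 / 8)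
    (hsw : s ^ 2 ≤ wt m x / m) :
    |∑ k ∈ Finset.range (2 * l + 1), (-1 : ℝ) ^ k * ((2 * l).choose k : ℝ) * f (x + k * s)| ≤
      Znorm lam (2 * l) f * (8 / m) ^ (lam / 2) := by
  have hZ := Znorm_nonneg hf
  have hm0 : 0 < (m : ℝ) := by positivity
  have hl1 : (1 : ℝ) ≤ l := by exact_mod_cast hl
  rcases eq_or_ne s 0 with rfl | hs0
  · have e : ∑ k ∈ Finset.range (2 * l + 1),
        (-1 : ℝ) ^ k * ((2 * l).choose k : ℝ) * f (x + k * 0) = 0 := by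
      simp only [mul_zero, add_zero]
      rw [← Finset.sum_mul]
      have := Int.alternating_sum_range_choose_of_ne (n := 2 * l) (by omega)
      have h : ∑ k ∈ Finset.range (2 * l + 1), (-1 : ℝ) ^ k * ((2 * l).choose k : ℝ) = 0 := by
        exact_mod_cast this
      rw [h, zero_mul]
    rw [e, abs_zero]
    positivity
  have hsp := abs_pos.mpr hs0
  set X := (x + l * s) * (1 - (x + l * s)) with hX
  set η := |s| with hη
  have hsq : s ^ 2 = η ^ 2 := (sq_abs s).symm
  have hw : wt m x ≤ x * (1 - x) + 1 / m := max_le (by linarith [show 0 < 1 / (m : ℝ) by positivity])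
    (by nlinarith [hx.1, hx.2])
  have key : x + 2 * l * s ∈ Icc (0 : ℝ) 1 ∧ x * (1 - x) / 4 ≤ X ∧ η / 4 ≤ X := by
    rcases hsx with ⟨h, h'⟩ | ⟨h, h'⟩
    · have e : η = s := abs_of_nonneg h
      rw [e] at hs hsp ⊢
      have h1 : s ≤ l * s := by nlinarith
      have h2 : x + l * s ≤ 3 / 4 := by linarith
      have h3 : (x + l * s) / 4 ≤ X := by
        rw [hX]; nlinarith [hx.1]
      refine ⟨⟨by nlinarith [hx.1], by linarith⟩, ?_, ?_⟩ <;> nlinarith [hx.1]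
    · have e : η = -s := abs_of_nonpos h
      rw [e] at hs hsp ⊢
      have h1 : -s ≤ l * -s := by nlinarith
      have h2 : 1 / 4 ≤ x + l * s := by linarith
      have h3 : (1 - (x + l * s)) / 4 ≤ X := by
        rw [hX]; nlinarith [hx.2]
      refine ⟨⟨by linarith, by nlinarith [hx.2]⟩, ?_, ?_⟩ <;> nlinarith [hx.1, hx.2]
  obtain ⟨hmem, hX1, hX2⟩ := key
  have hX0 : 0 < X := by linarith
  refine (abs_sum_shift_le hf hs0 hx hmem hX0).trans (mul_le_mul_of_nonneg_left ?_ hZ)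
  have hsq2 : (η / √X) ^ 2 ≤ 8 / m := by
    rw [div_pow, Real.sq_sqrt hX0.le, div_le_div_iff₀ hX0 hm0]
    rw [hsq, le_div_iff₀ hm0] at hsw
    have hwt : wt m x ≤ max (x * (1 - x)) (1 / m) := le_rfl
    rcases max_cases (x * (1 - x)) (1 / (m : ℝ)) with ⟨h, h'⟩ | ⟨h, h'⟩ <;> rw [h] at hwt
    · linarith
    · have h1 : (η * m) ^ 2 ≤ 1 := by
        have : η ^ 2 * m * m ≤ 1 / m * m := mul_le_mul_of_nonneg_right (hsw.trans hwt) hm0.le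
        rw [one_div_mul_cancel hm0.ne'] at this
        linarith [this]
      have h2 : η * m ≤ 1 := (sq_le_one_iff₀ (by positivity)).mp h1
      nlinarith
  calc (η / √X) ^ lam = ((η / √X) ^ 2) ^ (lam / 2) := by
        rw [← Real.rpow_natCast, ← Real.rpow_mul (by positivity)]
        congr 1
        push_cast
        ring
    _ ≤ _ := Real.rpow_le_rpow (by positivity) hsq2 (by linarith)

/-- Smooth approximation near a point, at a step adapted to the weight. -/
lemma exists_local_approx {lam : ℝ} (hlam : 0 < lam) {l : ℕ} (hl : 1 ≤ l) {f : ℝ → ℝ}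
    (hf : memZ lam (2 * l) f) {m : ℕ} (hm : 1 ≤ m) (y : ℝ) {h : ℝ}
    (hh : 0 < h) (hlh : (2 * l) ^ 2 * h ≤ 1 / 8) :
    ∃ g : ℝ → ℝ, ContDiff ℝ (2 * l : ℕ) g ∧ ∀ x ∈ Icc (0 : ℝ) 1, |x - y| ≤ 1 / 8 →
      (2 * l * h) ^ 2 ≤ wt m x / m →
      |f x - g x| ≤ Znorm lam (2 * l) f * (8 / m) ^ (lam / 2) ∧
      |iteratedDeriv (2 * l) g x| ≤
        2 ^ (2 * l) * (Znorm lam (2 * l) f * (8 / m) ^ (lam / 2)) / h ^ (2 * l) := by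
  set fe : ℝ → ℝ := IccExtend (zero_le_one' ℝ) (domRestrict (Icc 0 1) f) with hfe
  have hfec : Continuous fe := (continuousOn_iff_continuous_domRestrict.mp hf.1).Icc_extend'
  have hfeq : ∀ x ∈ Icc (0 : ℝ) 1, fe x = f x := fun x hx => IccExtend_of_mem _ _ hx
  obtain ⟨s, hs, hsy⟩ : ∃ s, |s| = h ∧ (0 ≤ s ∧ y ≤ 1 / 2 ∨ s ≤ 0 ∧ 1 / 2 ≤ y) := by
    rcases le_total y (1 / 2) with hy | hy
    · exact ⟨h, abs_of_pos hh, .inl ⟨hh.le, hy⟩⟩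
    · exact ⟨-h, by rw [abs_neg, abs_of_pos hh], .inr ⟨by linarith, hy⟩⟩
  have hs0 : s ≠ 0 := abs_pos.mp (hs ▸ hh)
  have hl0 : (0 : ℝ) ≤ l := by positivity
  obtain ⟨g, hg, hgx⟩ := exists_contDiff_abs_sub_le (2 * l) hfec hs0
  refine ⟨g, hg, fun x hx hxy hw => ?_⟩
  rw [← hfeq x hx, ← hs]
  refine hgx x _ fun v hv => ?_
  have hv0 := hv.1
  have hv1 : v ≤ 2 * l := by simpa using hv.2
  have hxy' := abs_le.mp hxy
  have hsv : |s * v| ≤ 2 * l * h := by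
    rw [abs_mul, abs_of_nonneg hv0, hs, mul_comm]
    exact mul_le_mul_of_nonneg_right hv1 hh.le
  have hlsv : 2 * l * |s * v| ≤ 1 / 8 := by nlinarith
  have hside : 0 ≤ s * v ∧ x ≤ 5 / 8 ∨ s * v ≤ 0 ∧ 3 / 8 ≤ x := by
    rcases hsy with ⟨h1, h2⟩ | ⟨h1, h2⟩
    · exact .inl ⟨mul_nonneg h1 hv0, by linarith⟩
    · exact .inr ⟨mul_nonpos_of_nonpos_of_nonneg h1 hv0, by linarith⟩
  have hmain := abs_sum_shift_le_of_sq_le hlam hl hf hm hx hside hlsv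
    ((by rw [← sq_abs]; exact pow_le_pow_left₀ (abs_nonneg _) hsv 2 :
      (s * v) ^ 2 ≤ (2 * l * h) ^ 2).trans hw)
  have hmem : ∀ k ∈ Finset.range (2 * l + 1), x + k * (s * v) ∈ Icc (0 : ℝ) 1 := by
    intro k hk
    have hk' : (k : ℝ) ≤ 2 * l := by
      have : k ≤ 2 * l := by have := Finset.mem_range.mp hk; omega
      exact_mod_cast this
    have h1 : |k * (s * v)| ≤ 1 / 8 := by
      rw [abs_mul, Nat.abs_cast]
      exact (mul_le_mul_of_nonneg_right hk' (abs_nonneg _)).trans hlsv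
    have h1' := abs_le.mp h1
    have hk0 : (0 : ℝ) ≤ k := by positivity
    rcases hside with ⟨h2, h3⟩ | ⟨h2, h3⟩
    · exact ⟨by nlinarith [hx.1], by linarith⟩
    · exact ⟨by linarith, by nlinarith [hx.2]⟩
  rw [Finset.sum_congr rfl fun k hk => by rw [hfeq _ (hmem k hk)]]
  exact hmain

lemma sin_sq_sub_sin_sq (a b : ℝ) :
    Real.sin b ^ 2 - Real.sin a ^ 2 = Real.sin (b - a) * Real.sin (b + a) := by
  rw [Real.sin_add, Real.sin_sub]
  linear_combination Real.sin a ^ 2 * Real.sin_sq_add_cos_sq b -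
    Real.sin b ^ 2 * Real.sin_sq_add_cos_sq a

lemma exists_mem_Icc_succ {x : ℕ → ℝ} {y : ℝ} (h0 : x 0 ≤ y) (n : ℕ) (hn : y ≤ x (n + 1)) :
    ∃ p < n + 1, y ∈ Icc (x p) (x (p + 1)) := by
  induction n with
  | zero => exact ⟨0, by omega, h0, hn⟩
  | succ n ih =>
    rcases le_total y (x (n + 1)) with h | h
    · obtain ⟨p, hp, hy⟩ := ih h
      exact ⟨p, by omega, hy⟩
    · exact ⟨n + 1, by omega, h, hn⟩

/-- A partition of `[0,1]` whose mesh is locally comparable to `√(w/m)`. -/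
lemma exists_partition {m : ℕ} (hm : 1 ≤ m) : ∃ (N : ℕ) (x : ℕ → ℝ), x 0 = 0 ∧ x (N + 1) = 1 ∧
    ∀ p < N + 1, x p < x (p + 1) ∧ x (p + 1) - x p ≤ 1 / 8 ∧ 0 ≤ x p ∧ x (p + 1) ≤ 1 ∧
      ∀ y ∈ Icc (x p) (x (p + 1)), (x (p + 1) - x p) ^ 2 ≤ wt m y / m ∧
        wt m y / m ≤ 4000000 * (x (p + 1) - x p) ^ 2 := by
  have hm1 : (1 : ℝ) ≤ m := by exact_mod_cast hm
  have hm0 : 0 < (m : ℝ) := by linarith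
  set T : ℝ := 1 / √m with hT
  have hsm : 1 ≤ √(m : ℝ) := Real.one_le_sqrt.mpr hm1
  have hT0 : 0 < T := by positivity
  have hT1 : T ≤ 1 := by rw [hT, div_le_one (by positivity)]; exact hsm
  have hTT : T ^ 2 = 1 / m := by rw [hT, div_pow, Real.sq_sqrt hm0.le, one_pow]
  set n : ℕ := ⌈√(m : ℝ)⌉₊ with hn
  have hn1 : √(m : ℝ) ≤ n := Nat.le_ceil _
  have hn2 : (n : ℝ) ≤ 2 * √m := by
    have := Nat.ceil_lt_add_one (Real.sqrt_nonneg (m : ℝ))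
    linarith
  have hn0 : 0 < (n : ℝ) := by linarith
  have hn0' : 0 < n := by exact_mod_cast hn0
  obtain ⟨N, hN⟩ : ∃ N, 16 * n = N + 1 := ⟨16 * n - 1, by omega⟩
  set δ : ℝ := Real.pi / (32 * n) with hδ
  have hpi := Real.pi_gt_three
  have hpi4 : Real.pi < 3.15 := Real.pi_lt_d2
  have hδ0 : 0 < δ := by positivity
  have hδT : δ ≤ T / 10 := by
    rw [hδ, hT, div_div, div_le_div_iff₀ (by positivity) (by positivity)]
    nlinarith
  have hTδ : T ≤ 22 * δ := by
    rw [hδ, hT, mul_div_assoc', div_le_div_iff₀ (by positivity) (by positivity)]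
    nlinarith
  have hNδ : ((N + 1 : ℕ) : ℝ) * δ = Real.pi / 2 := by
    rw [← hN, hδ]
    push_cast
    field_simp
    norm_num
  have hsδ : δ / 2 ≤ Real.sin δ := by
    have h := Real.mul_le_sin hδ0.le (by linarith)
    refine le_trans ?_ h
    rw [div_eq_mul_inv, mul_comm]
    refine mul_le_mul_of_nonneg_right ?_ hδ0.le
    rw [inv_eq_one_div, div_le_div_iff₀ (by norm_num) (by positivity)]
    linarith
  have hsδ' : Real.sin δ ≤ δ := Real.sin_le hδ0.le
  refine ⟨N, fun p => Real.sin (p * δ) ^ 2, by simp, by simp only [hNδ]; simp, fun p hp => ?_⟩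
  set a : ℝ := p * δ with ha
  have hb : ((p + 1 : ℕ) : ℝ) * δ = a + δ := by push_cast; ring
  have ha0 : 0 ≤ a := by positivity
  have hbpi : a + δ ≤ Real.pi / 2 := by
    rw [← hb, ← hNδ]
    refine mul_le_mul_of_nonneg_right ?_ hδ0.le
    exact_mod_cast hp
  simp only [hb]
  set σ := Real.sin (2 * a + δ) with hσ
  have hΔ : Real.sin (a + δ) ^ 2 - Real.sin a ^ 2 = Real.sin δ * σ := by
    rw [sin_sq_sub_sin_sq, hσ]
    congr 2 <;> ring
  have hσδ : Real.sin δ ≤ σ := by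
    have h := Real.sin_sub_sin (2 * a + δ) δ
    have h1 : 0 ≤ Real.sin ((2 * a + δ - δ) / 2) :=
      Real.sin_nonneg_of_nonneg_of_le_pi (by linarith) (by linarith)
    have h2 : 0 ≤ Real.cos ((2 * a + δ + δ) / 2) :=
      Real.cos_nonneg_of_neg_pi_div_two_le_of_le (by linarith) (by linarith)
    have := mul_nonneg h1 h2
    linarith
  have hs0 : 0 < Real.sin δ := by linarith
  have hσ0 : 0 < σ := by linarith
  have hσ1 : σ ≤ 1 := Real.sin_le_one _
  rw [hΔ]
  refine ⟨by nlinarith, by nlinarith, by positivity, Real.sin_sq_le_one _, fun y hy => ?_⟩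
  obtain ⟨θ, hθ, hyθ⟩ := intermediate_value_Icc (by linarith : a ≤ a + δ)
    (f := fun θ => Real.sin θ ^ 2) (by fun_prop) hy
  simp only at hyθ
  set S := Real.sin (2 * θ) with hS
  have hS0 : 0 ≤ S := Real.sin_nonneg_of_nonneg_of_le_pi (by linarith [hθ.1]) (by linarith [hθ.2])
  have hyS : y * (1 - y) = S ^ 2 / 4 := by
    rw [hS, Real.sin_two_mul, ← hyθ]
    linear_combination (-Real.sin θ ^ 2) * (Real.sin_sq_add_cos_sq θ)
  have hSσ : |σ - S| ≤ δ := by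
    refine (Real.abs_sin_sub_sin_le _ _).trans ?_
    exact abs_le.mpr ⟨by linarith [hθ.2], by linarith [hθ.1]⟩
  have hSσ' := abs_le.mp hSσ
  have hw1 := le_wt m y
  have hw2 := inv_le_wt m y
  have hw3 : wt m y ≤ S ^ 2 / 4 + T ^ 2 := by
    unfold wt
    rw [hyS, hTT]
    exact max_le (by linarith [show 0 < 1 / (m : ℝ) by positivity]) (by linarith [sq_nonneg S])
  rw [hyS] at hw1
  rw [← hTT] at hw2
  rw [div_eq_mul_one_div, ← hTT]
  constructor
  · have h1 : Real.sin δ * σ ≤ T / 10 * (S + T / 10) :=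
      mul_le_mul (by linarith) (by linarith) hσ0.le (by positivity)
    have h2 := pow_le_pow_left₀ (by positivity) h1 2
    refine h2.trans ?_
    have h3 : (S + T / 10) ^ 2 ≤ 100 * wt m y := by
      have e : (S + T / 10) ^ 2 = 2 * S ^ 2 + T ^ 2 / 50 - (S - T / 10) ^ 2 := by ring
      linarith [sq_nonneg (S - T / 10)]
    calc (T / 10 * (S + T / 10)) ^ 2 = T ^ 2 / 100 * (S + T / 10) ^ 2 := by ring
      _ ≤ T ^ 2 / 100 * (100 * wt m y) := mul_le_mul_of_nonneg_left h3 (by positivity)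
      _ = _ := by ring
  · have h1 : wt m y ≤ 2000 * σ ^ 2 := by
      have e1 := pow_le_pow_left₀ hS0 (by linarith : S ≤ 3 * σ) 2
      have e2 := pow_le_pow_left₀ hT0.le (by linarith : T ≤ 44 * σ) 2
      rw [mul_pow] at e1 e2
      linarith [sq_nonneg σ]
    have h2 : T ^ 2 ≤ 2000 * Real.sin δ ^ 2 := by
      have e2 := pow_le_pow_left₀ hT0.le (by linarith : T ≤ 44 * Real.sin δ) 2
      rw [mul_pow] at e2
      linarith [sq_nonneg (Real.sin δ)]
    calc wt m y * T ^ 2 ≤ 2000 * σ ^ 2 * (2000 * Real.sin δ ^ 2) :=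
          mul_le_mul h1 h2 (by positivity) (by positivity)
      _ = _ := by ring

lemma exists_abs_iteratedDeriv_smoothTransition_le (r : ℕ) : ∃ K : ℝ, 0 ≤ K ∧
    ∀ i ≤ r, ∀ y ∈ Icc (0 : ℝ) 1, |iteratedDeriv i Real.smoothTransition y| ≤ K := by
  have h : ∀ i, ∃ B, ∀ y ∈ Icc (0 : ℝ) 1, |iteratedDeriv i Real.smoothTransition y| ≤ B := fun i =>
    exists_abs_le_of_continuousOn
      ((Real.smoothTransition.contDiff (n := i)).continuous_iteratedDeriv' i).continuousOn
  choose B hB using h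
  have hB0 : ∀ i, 0 ≤ B i := fun i => (abs_nonneg _).trans (hB i 0 (by simp))
  refine ⟨∑ i ∈ Finset.range (r + 1), B i, Finset.sum_nonneg fun i _ => hB0 i,
    fun i hi y hy => (hB i y hy).trans ?_⟩
  exact Finset.single_le_sum (f := B) (fun i _ => hB0 i) (Finset.mem_range.mpr (by omega))

/-- Derivative bound for the blend of two close functions over an interval. -/
lemma exists_abs_iteratedDeriv_blend_le (r : ℕ) (hr : 1 ≤ r) : ∃ K : ℝ, 0 ≤ K ∧
    ∀ g e : ℝ → ℝ, ContDiff ℝ r g → ContDiff ℝ r e → ∀ a D ε b : ℝ, 0 < D → 0 ≤ ε → 0 ≤ b →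
      (∀ y ∈ Icc a (a + D), |e y| ≤ 2 * ε) →
      (∀ y ∈ Icc a (a + D), |iteratedDeriv r g y| ≤ b * ε / D ^ r) →
      (∀ y ∈ Icc a (a + D), |iteratedDeriv r e y| ≤ 2 * (b * ε / D ^ r)) →
      ∀ y ∈ Icc a (a + D),
        |iteratedDeriv r (fun y => g y + Real.smoothTransition ((y - a) / D) * e y) y| ≤
          K * (1 + b) * ε / D ^ r := by
  obtain ⟨K₁, hK₁, hS⟩ := exists_abs_iteratedDeriv_smoothTransition_le r
  obtain ⟨K₂, hK₂, hL⟩ := exists_abs_iteratedDeriv_mul_le r hr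
  refine ⟨1 + 2 ^ r * (K₁ * (2 ^ r * (2 * K₂))), by positivity,
    fun g e hg he a D ε b hD hε hb he0 hgr her y hy => ?_⟩
  set T : ℝ → ℝ := fun y => Real.smoothTransition ((y - a) / D) with hT
  have hTeq : T = fun y => Real.smoothTransition (-(a / D) + D⁻¹ * y) := by
    funext y
    have h1 : (y - a) / D = -(a / D) + D⁻¹ * y := by field_simp; ring
    simp only [hT, h1]
  have hTc : ContDiff ℝ r T := by
    rw [hTeq]
    exact Real.smoothTransition.contDiff.comp (contDiff_const.add (contDiff_const.mul contDiff_id))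
  have hTi : ∀ i ≤ r, |iteratedDeriv i T y| * D ^ i ≤ K₁ := by
    intro i hi
    rw [hTeq, iteratedDeriv_comp_add_mul Real.smoothTransition.contDiff, abs_mul, abs_pow, abs_inv,
      abs_of_pos hD, inv_pow]
    have h1 : -(a / D) + D⁻¹ * y = (y - a) / D := by field_simp; ring
    rw [h1]
    have h2 := hS i hi ((y - a) / D) ⟨div_nonneg (by linarith [hy.1]) hD.le,
      (div_le_one hD).mpr (by linarith [hy.2])⟩
    calc _ = |iteratedDeriv i Real.smoothTransition ((y - a) / D)| := by field_simp
      _ ≤ _ := h2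
  obtain ⟨d, hd, hdy⟩ : ∃ d, |d| = D / 2 ∧ ∀ v ∈ Icc (0 : ℝ) 1, y + d * v ∈ Icc a (a + D) := by
    rcases le_total y (a + D / 2) with h | h
    · refine ⟨D / 2, abs_of_pos (by positivity), fun v hv => ⟨?_, ?_⟩⟩
      · nlinarith [hy.1, hv.1]
      · nlinarith [hv.2]
    · refine ⟨-(D / 2), by rw [abs_neg, abs_of_pos (by positivity)], fun v hv => ⟨?_, ?_⟩⟩
      · nlinarith [hv.2]
      · nlinarith [hy.2, hv.1]
  have hei : ∀ i ≤ r, |iteratedDeriv i e y| * D ^ i ≤ 2 ^ r * (2 * K₂) * (1 + b) * ε := by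
    intro i hi
    have h := hL e he y d (2 * ε) (2 * (b * ε / D ^ r)) (fun v hv => he0 _ (hdy v hv))
      (fun v hv => her _ (hdy v hv)) i hi
    rw [hd] at h
    have h1 : 2 * (b * ε / D ^ r) * (D / 2) ^ r ≤ 2 * (b * ε) := by
      have e1 : 2 * (b * ε / D ^ r) * (D / 2) ^ r = 2 * (b * ε) / 2 ^ r := by
        rw [div_pow]; field_simp
      rw [e1]
      exact div_le_self (by positivity) (one_le_pow₀ (by norm_num))
    have h2 : |iteratedDeriv i e y| * (D / 2) ^ i ≤ 2 * K₂ * (1 + b) * ε :=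
      h.trans ((mul_le_mul_of_nonneg_left (add_le_add_right h1 _) (by positivity)).trans_eq
        (by ring))
    have h3 : (2 : ℝ) ^ i ≤ 2 ^ r := pow_le_pow_right₀ (by norm_num) hi
    calc |iteratedDeriv i e y| * D ^ i = 2 ^ i * (|iteratedDeriv i e y| * (D / 2) ^ i) := by
          rw [div_pow]; field_simp
      _ ≤ 2 ^ r * (2 * K₂ * (1 + b) * ε) := mul_le_mul h3 h2 (by positivity) (by positivity)
      _ = _ := by ring
  have hprod : |iteratedDeriv r (fun y => T y * e y) y| * D ^ r ≤
      2 ^ r * (K₁ * (2 ^ r * (2 * K₂) * (1 + b) * ε)) := by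
    rw [iteratedDeriv_fun_mul hTc.contDiffAt he.contDiffAt]
    refine (mul_le_mul_of_nonneg_right (Finset.abs_sum_le_sum_abs _ _) (by positivity)).trans ?_
    rw [Finset.sum_mul]
    have hsum : (2 : ℝ) ^ r = ∑ k ∈ Finset.range (r + 1), (r.choose k : ℝ) := by
      exact_mod_cast (Nat.sum_range_choose r).symm
    rw [show (2 : ℝ) ^ r * (K₁ * (2 ^ r * (2 * K₂) * (1 + b) * ε)) =
      (∑ k ∈ Finset.range (r + 1), (r.choose k : ℝ)) * (K₁ * (2 ^ r * (2 * K₂) * (1 + b) * ε)) by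
        rw [← hsum], Finset.sum_mul]
    refine Finset.sum_le_sum fun i hi => ?_
    have hi' : i ≤ r := by have := Finset.mem_range.mp hi; omega
    have hpw : D ^ r = D ^ i * D ^ (r - i) := by rw [← pow_add]; congr 1; omega
    rw [abs_mul, abs_mul, Nat.abs_cast, hpw]
    have h3 := mul_le_mul (hTi i hi') (hei (r - i) (by omega)) (by positivity) hK₁
    calc _ = (r.choose i : ℝ) * (|iteratedDeriv i T y| * D ^ i *
          (|iteratedDeriv (r - i) e y| * D ^ (r - i))) := by ring
      _ ≤ _ := mul_le_mul_of_nonneg_left h3 (by positivity)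
  have hsplit : iteratedDeriv r (fun y => g y + T y * e y) y =
      iteratedDeriv r g y + iteratedDeriv r (fun y => T y * e y) y :=
    iteratedDeriv_fun_add hg.contDiffAt (hTc.mul he).contDiffAt
  rw [hsplit, le_div_iff₀ (by positivity)]
  have hgy := hgr y hy
  rw [le_div_iff₀ (by positivity)] at hgy
  have habs := mul_le_mul_of_nonneg_right (abs_add_le (iteratedDeriv r g y)
    (iteratedDeriv r (fun y => T y * e y) y)) (by positivity : 0 ≤ D ^ r)
  nlinarith

/-- Gluing of local approximants over a partition. -/
lemma exists_glue (r : ℕ) (hr : 1 ≤ r) : ∃ K : ℝ, 0 ≤ K ∧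
    ∀ (N : ℕ) (x : ℕ → ℝ), (∀ p < N, x p < x (p + 1)) → ∀ (f : ℝ → ℝ) (g : ℕ → ℝ → ℝ) (ε b : ℝ),
      0 ≤ ε → 0 ≤ b → (∀ p, ContDiff ℝ r (g p)) →
      (∀ p < N, ∀ q, q = p ∨ q = p + 1 → ∀ y ∈ Icc (x p) (x (p + 1)), |f y - g q y| ≤ ε ∧
        |iteratedDeriv r (g q) y| ≤ b * ε / (x (p + 1) - x p) ^ r) →
      ∃ G : ℝ → ℝ, ContDiff ℝ r G ∧ ∀ p < N, ∀ y ∈ Icc (x p) (x (p + 1)), |f y - G y| ≤ ε ∧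
        |iteratedDeriv r G y| ≤ K * (1 + b) * ε / (x (p + 1) - x p) ^ r := by
  obtain ⟨K, hK, hblend⟩ := exists_abs_iteratedDeriv_blend_le r hr
  refine ⟨K, hK, fun N x hx f g ε b hε hb hg hloc => ?_⟩
  set e : ℕ → ℝ → ℝ := fun p y => g (p + 1) y - g p y with he
  set T : ℕ → ℝ → ℝ := fun p y => Real.smoothTransition ((y - x p) / (x (p + 1) - x p)) with hT
  set G : ℝ → ℝ := fun y => g 0 y + ∑ p ∈ Finset.range N, T p y * e p y with hG
  have hec : ∀ p, ContDiff ℝ r (e p) := fun p => (hg (p + 1)).sub (hg p)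
  have hTc : ∀ p, ContDiff ℝ r (T p) := fun p =>
    Real.smoothTransition.contDiff.comp ((contDiff_id.sub contDiff_const).div_const _)
  have hGc : ContDiff ℝ r G :=
    (hg 0).add (ContDiff.sum fun p _ => (hTc p).mul (hec p))
  have hmono : ∀ p q, p ≤ q → q ≤ N → x p ≤ x q := by
    intro p q hpq
    induction q, hpq using Nat.le_induction with
    | base => exact fun _ => le_rfl
    | succ q _ ih => exact fun h => (ih (by omega)).trans (hx q (by omega)).le
  have hGloc : ∀ p < N, ∀ y ∈ Icc (x p) (x (p + 1)), G y = g p y + T p y * e p y := by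
    intro p hp y hy
    have h1 : ∑ q ∈ Finset.range p, T q y * e q y = g p y - g 0 y := by
      rw [← Finset.sum_range_sub (fun q => g q y)]
      refine Finset.sum_congr rfl fun q hq => ?_
      have hq' := Finset.mem_range.mp hq
      have hΔ : 0 < x (q + 1) - x q := by linarith [hx q (by omega)]
      have : T q y = 1 := Real.smoothTransition.one_of_one_le (by
        rw [le_div_iff₀ hΔ]
        linarith [hmono (q + 1) p (by omega) (by omega), hy.1])
      rw [this, one_mul]
    have h2 : ∑ q ∈ Finset.Ico (p + 1) N, T q y * e q y = 0 := by
      refine Finset.sum_eq_zero fun q hq => ?_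
      have hq' := Finset.mem_Ico.mp hq
      have hΔ : 0 < x (q + 1) - x q := by linarith [hx q (by omega)]
      have : T q y = 0 := Real.smoothTransition.zero_of_nonpos
        (div_nonpos_of_nonpos_of_nonneg
          (by linarith [hmono (p + 1) q (by omega) (by omega), hy.2]) hΔ.le)
      rw [this, zero_mul]
    have h3 := Finset.sum_range_add_sum_Ico (fun q => T q y * e q y) (show p + 1 ≤ N by omega)
    rw [h2, add_zero, Finset.sum_range_succ, h1] at h3
    rw [hG]
    simp only
    rw [← h3]
    ring
  refine ⟨G, hGc, fun p hp => ?_⟩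
  have hΔ : 0 < x (p + 1) - x p := by linarith [hx p hp]
  have hend : x p + (x (p + 1) - x p) = x (p + 1) := by ring
  have hIoo : ∀ y ∈ Ioo (x p) (x (p + 1)), |iteratedDeriv r G y| ≤
      K * (1 + b) * ε / (x (p + 1) - x p) ^ r := by
    intro y hy
    have hev : G =ᶠ[nhds y] fun y => g p y + T p y * e p y := by
      filter_upwards [Ioo_mem_nhds hy.1 hy.2] with z hz
      exact hGloc p hp z (Ioo_subset_Icc_self hz)
    rw [hev.iteratedDeriv_eq r]
    refine hblend (g p) (e p) (hg p) (hec p) (x p) (x (p + 1) - x p) ε b hΔ hε hb ?_ ?_ ?_ y ?_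
    · intro z hz
      rw [hend] at hz
      have h1 := abs_le.mp (hloc p hp p (.inl rfl) z hz).1
      have h2 := abs_le.mp (hloc p hp (p + 1) (.inr rfl) z hz).1
      exact abs_le.mpr ⟨by simp only [he]; linarith, by simp only [he]; linarith⟩
    · intro z hz
      rw [hend] at hz
      exact (hloc p hp p (.inl rfl) z hz).2
    · intro z hz
      rw [hend] at hz
      rw [he]
      simp only
      rw [iteratedDeriv_fun_sub (hg (p + 1)).contDiffAt (hg p).contDiffAt]
      have h1 := (hloc p hp p (.inl rfl) z hz).2
      have h2 := (hloc p hp (p + 1) (.inr rfl) z hz).2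
      have := abs_sub (iteratedDeriv r (g (p + 1)) z) (iteratedDeriv r (g p) z)
      linarith
    · rw [hend]
      exact Ioo_subset_Icc_self hy
  have hcl : IsClosed {y | |iteratedDeriv r G y| ≤ K * (1 + b) * ε / (x (p + 1) - x p) ^ r} :=
    isClosed_le (hGc.continuous_iteratedDeriv' r).abs continuous_const
  have hIcc := closure_minimal hIoo hcl
  rw [closure_Ioo (hx p hp).ne] at hIcc
  intro y hy
  refine ⟨?_, hIcc hy⟩
  rw [hGloc p hp y hy]
  have h1 := abs_le.mp (hloc p hp p (.inl rfl) y hy).1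
  have h2 := abs_le.mp (hloc p hp (p + 1) (.inr rfl) y hy).1
  have hT0 : 0 ≤ T p y := Real.smoothTransition.nonneg _
  have hT1 : T p y ≤ 1 := Real.smoothTransition.le_one _
  have e1 : f y - (g p y + T p y * e p y) =
      (1 - T p y) * (f y - g p y) + T p y * (f y - g (p + 1) y) := by
    simp only [he]; ring
  rw [e1]
  exact abs_le.mpr ⟨by nlinarith, by nlinarith⟩

/-- Smooth approximation of a function in `Z_λ` with weighted control of the top derivative. -/
theorem exists_smooth_approx {lam : ℝ} (hlam : 0 < lam) {l : ℕ} (hl : 1 ≤ l) : ∃ C : ℝ, 1 ≤ C ∧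
    ∀ f : ℝ → ℝ, memZ lam (2 * l) f → ∀ m : ℕ, 1 ≤ m → ∃ g : ℝ → ℝ, ContDiff ℝ (2 * l : ℕ) g ∧
      ∀ y ∈ Icc (0 : ℝ) 1,
        |f y - g y| ≤ C * Znorm lam (2 * l) f * (m : ℝ) ^ (-(lam / 2)) ∧
        |iteratedDeriv (2 * l) g y| ≤
          C * Znorm lam (2 * l) f * (m : ℝ) ^ (-(lam / 2)) / (wt m y / m) ^ l := by
  obtain ⟨K, hK, hglue⟩ := exists_glue (2 * l) (by omega)
  have hl1 : (1 : ℝ) ≤ l := by exact_mod_cast hl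
  set c : ℝ := 1 / (4000 * l ^ 2) with hc
  have hc0 : 0 < c := by positivity
  set b : ℝ := 2 ^ (2 * l) / c ^ (2 * l) with hb
  have hb0 : 0 ≤ b := by positivity
  set C : ℝ := 8 ^ (lam / 2) * (1 + K * (1 + b) * 4000000 ^ l) with hC
  have h8 : (1 : ℝ) ≤ 8 ^ (lam / 2) := Real.one_le_rpow (by norm_num) (by linarith)
  have hKb : 0 ≤ K * (1 + b) * 4000000 ^ l := by positivity
  refine ⟨C, by rw [hC]; nlinarith, fun f hf m hm => ?_⟩
  have hm0 : 0 < (m : ℝ) := by positivity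
  have hZ := Znorm_nonneg hf
  set ε : ℝ := Znorm lam (2 * l) f * (8 / m) ^ (lam / 2) with hε
  have hε0 : 0 ≤ ε := by positivity
  have hεC : ε * (1 + K * (1 + b) * 4000000 ^ l) =
      C * Znorm lam (2 * l) f * (m : ℝ) ^ (-(lam / 2)) := by
    rw [hε, hC, Real.div_rpow (by norm_num) hm0.le, Real.rpow_neg hm0.le]
    ring
  obtain ⟨N, x, hx0, hxN, hx⟩ := exists_partition hm
  set h : ℕ → ℝ := fun q => c * √(wt m (x q) / m) with hh
  have hwm : ∀ y, 0 < wt m y / m := fun y => div_pos (wt_pos hm y) hm0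
  have hh0 : ∀ q, 0 < h q := fun q => mul_pos hc0 (Real.sqrt_pos.mpr (hwm _))
  have hhsq : ∀ q, h q ^ 2 = c ^ 2 * (wt m (x q) / m) := fun q => by
    rw [hh]
    simp only
    rw [mul_pow, Real.sq_sqrt (hwm _).le]
  have hlh : ∀ q, (2 * l) ^ 2 * h q ≤ 1 / 8 := by
    intro q
    have h1 : √(wt m (x q) / m) ≤ 1 := by
      refine Real.sqrt_le_one.mpr ?_
      rw [div_le_one hm0]
      exact (wt_le_one hm _).trans (by exact_mod_cast hm)
    have h2 : (2 * (l : ℝ)) ^ 2 * c = 1 / 1000 := by rw [hc]; field_simp; norm_num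
    calc (2 * (l : ℝ)) ^ 2 * h q = (2 * (l : ℝ)) ^ 2 * c * √(wt m (x q) / m) := by rw [hh]; ring
      _ ≤ 1 / 1000 * 1 := by rw [h2]; gcongr
      _ ≤ 1 / 8 := by norm_num
  choose g hgc hg using fun q => exists_local_approx hlam hl hf hm (x q) (hh0 q) (hlh q)
  obtain ⟨G, hGc, hG⟩ := hglue (N + 1) x (fun p hp => (hx p hp).1) f g ε b hε0 hb0 hgc (by
    intro p hp q hq y hy
    obtain ⟨hlt, h18, hp0, hp1, hmesh⟩ := hx p hp
    have hqm : x q ∈ Icc (x p) (x (p + 1)) := by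
      rcases hq with rfl | rfl
      · exact left_mem_Icc.mpr hlt.le
      · exact right_mem_Icc.mpr hlt.le
    have hq1 := hmesh (x q) hqm
    have hy1 := hmesh y hy
    set D := x (p + 1) - x p with hD
    have hD0 : 0 < D := by linarith
    have hcl : (2 * (l : ℝ)) ^ 2 * c ^ 2 * 4000000 ≤ 1 := by
      have : (2 * (l : ℝ)) ^ 2 * c ^ 2 * 4000000 = 1 / l ^ 2 := by rw [hc]; field_simp; norm_num
      rw [this, div_le_one (by positivity)]
      nlinarith
    obtain ⟨r1, r2⟩ := hg q y ⟨by linarith [hy.1], by linarith [hy.2]⟩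
      (abs_le.mpr ⟨by linarith [hy.1, hqm.2], by linarith [hy.2, hqm.1]⟩) (by
        rw [mul_pow, hhsq]
        have e1 : wt m (x q) / m ≤ 4000000 * (wt m y / m) := by linarith [hq1.2, hy1.1]
        calc (2 * (l : ℝ)) ^ 2 * (c ^ 2 * (wt m (x q) / m))
            ≤ (2 * (l : ℝ)) ^ 2 * (c ^ 2 * (4000000 * (wt m y / m))) := by gcongr
          _ = (2 * (l : ℝ)) ^ 2 * c ^ 2 * 4000000 * (wt m y / m) := by ring
          _ ≤ 1 * (wt m y / m) := mul_le_mul_of_nonneg_right hcl (hwm y).le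
          _ = _ := one_mul _)
    refine ⟨r1, r2.trans ?_⟩
    have e2 : c * D ≤ h q := by
      refine le_of_sq_le_sq ?_ (hh0 q).le
      rw [mul_pow, hhsq]
      exact mul_le_mul_of_nonneg_left hq1.1 (by positivity)
    calc 2 ^ (2 * l) * ε / h q ^ (2 * l) ≤ 2 ^ (2 * l) * ε / (c * D) ^ (2 * l) := by gcongr
      _ = b * ε / D ^ (2 * l) := by rw [hb, mul_pow]; field_simp)
  refine ⟨G, hGc, fun y hy => ?_⟩
  obtain ⟨p, hp, hyp⟩ := exists_mem_Icc_succ (x := x) (y := y) (by rw [hx0]; exact hy.1) N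
    (by rw [hxN]; exact hy.2)
  obtain ⟨r1, r2⟩ := hG p hp y hyp
  obtain ⟨hlt, -, -, -, hmesh⟩ := hx p hp
  have hD0 : 0 < x (p + 1) - x p := by linarith
  set D := x (p + 1) - x p with hD
  rw [← hεC]
  refine ⟨r1.trans (by nlinarith), r2.trans ?_⟩
  have hwy := hwm y
  rw [div_le_div_iff₀ (by positivity) (by positivity)]
  have e3 : (wt m y / m) ^ l ≤ 4000000 ^ l * D ^ (2 * l) := by
    rw [pow_mul, ← mul_pow]
    exact pow_le_pow_left₀ hwy.le (hmesh y hyp).2 l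
  calc K * (1 + b) * ε * (wt m y / m) ^ l ≤ K * (1 + b) * ε * (4000000 ^ l * D ^ (2 * l)) := by
        gcongr
    _ = ε * (K * (1 + b) * 4000000 ^ l) * D ^ (2 * l) := by ring
    _ ≤ _ := by gcongr; linarith

lemma Bop_eq_sum_smul (m : ℕ) (f : ℝ → ℝ) :
    Bop m f = ∑ j ∈ Finset.range (m + 1), f ((j : ℝ) / m) • bern m j := by
  funext x
  simp only [Bop, Finset.sum_apply, Pi.smul_apply, smul_eq_mul, mul_comm]

lemma BopLin_pow_apply (m n : ℕ) (f : ℝ → ℝ) : (BopLin m ^ n) f = (Bop m)^[n] f :=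
  Module.End.pow_apply _ _ _

/-- The error of the generalized Bernstein operator in terms of the fundamental polynomials. -/
lemma errLin_apply_eq (m l : ℕ) (f : ℝ → ℝ) (x : ℝ) :
    errLin m l f x = f x - ∑ j ∈ Finset.range (m + 1), gbBasis m l j x * f ((j : ℝ) / m) := by
  have hpow : errLin m l f x =
      ∑ i ∈ Finset.range (l + 1), (l.choose i : ℝ) * (-1) ^ i * (Bop m)^[i] f x := by
    have h1 : errLin m l = ∑ i ∈ Finset.range (l + 1),
        ((l.choose i : ℝ) * (-1) ^ i) • BopLin m ^ i := by
      have h0 : 1 - BopLin m = (-1 : ℝ) • BopLin m + 1 := by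
        refine LinearMap.ext fun g => ?_
        change g - BopLin m g = (-1 : ℝ) • BopLin m g + g
        rw [neg_one_smul, sub_eq_neg_add]
      rw [errLin, h0, (Commute.one_right _).add_pow]
      refine Finset.sum_congr rfl fun i _ => ?_
      rw [one_pow, mul_one, smul_pow, ← nsmul_eq_mul', mul_smul, Nat.cast_smul_eq_nsmul]
    rw [h1]
    simp [LinearMap.sum_apply, BopLin_pow_apply, Finset.sum_apply]
  have hit : ∀ i, (Bop m)^[i + 1] f x =
      ∑ j ∈ Finset.range (m + 1), f ((j : ℝ) / m) * (Bop m)^[i] (bern m j) x := by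
    intro i
    rw [Function.iterate_succ_apply, ← BopLin_pow_apply, Bop_eq_sum_smul, map_sum,
      Finset.sum_apply]
    exact Finset.sum_congr rfl fun j _ => by
      rw [map_smul, BopLin_pow_apply, Pi.smul_apply, smul_eq_mul]
  have hb : ∀ j, gbBasis m l j x = ∑ i ∈ Finset.range l,
      (l.choose (i + 1) : ℝ) * (-1) ^ i * (Bop m)^[i] (bern m j) x := by
    intro j
    rw [gbBasis, ← Finset.Ico_add_one_right_eq_Icc, Finset.sum_Ico_eq_sum_range]
    simp [add_comm]
  rw [hpow, Finset.sum_range_succ']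
  simp only [hit, hb, Finset.mul_sum, Finset.sum_mul]
  rw [Finset.sum_comm, add_comm, sub_eq_add_neg, ← Finset.sum_neg_distrib]
  congr 1
  · simp
  · refine Finset.sum_congr rfl fun j _ => ?_
    rw [← Finset.sum_neg_distrib]
    exact Finset.sum_congr rfl fun i _ => by ring

lemma continuous_bern (m j : ℕ) : Continuous (bern m j) := by
  unfold bern
  fun_prop

lemma continuous_iterate_Bop_bern (m j n : ℕ) : Continuous ((Bop m)^[n] (bern m j)) := by
  cases n with
  | zero => exact continuous_bern m j
  | succ n =>
    rw [Function.iterate_succ_apply']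
    exact continuous_finsetSum _ fun k _ => (continuous_bern m k).mul continuous_const

lemma continuous_gbBasis (m l j : ℕ) : Continuous (gbBasis m l j) :=
  continuous_finsetSum _ fun i _ => continuous_const.mul (continuous_iterate_Bop_bern m j (i - 1))

lemma intervalIntegrable_sub_rpow_mul_rpow {alp bet : ℝ} (halp : -1 < alp) (hbet : -1 < bet)
    {s : ℝ} (hs : 0 ≤ s) :
    IntervalIntegrable (fun t => (s - t) ^ alp * t ^ bet) volume 0 s := by
  rcases hs.eq_or_lt with rfl | hs
  · exact IntervalIntegrable.refl
  refine IntervalIntegrable.trans (b := s / 2) ?_ ?_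
  · refine (intervalIntegral.intervalIntegrable_rpow' hbet).continuousOn_mul ?_
    rw [uIcc_of_le (by linarith)]
    exact (continuousOn_const.sub continuousOn_id).rpow_const fun t ht =>
      .inl (sub_pos.mpr (lt_of_le_of_lt ht.2 (by linarith))).ne'
  · refine IntervalIntegrable.mul_continuousOn ?_ ?_
    · have := (intervalIntegral.intervalIntegrable_rpow' (a := s / 2) (b := 0) halp).comp_sub_left s
      simpa [sub_half] using this
    · rw [uIcc_of_le (by linarith)]
      exact continuousOn_id.rpow_const fun t ht => .inl (lt_of_lt_of_le (by linarith) ht.1).ne'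

lemma integral_sub_rpow_mul_rpow (alp bet : ℝ) {s : ℝ} (hs : 0 < s) :
    ∫ t in (0 : ℝ)..s, (s - t) ^ alp * t ^ bet =
      s ^ (alp + bet + 1) * ∫ t in (0 : ℝ)..1, (1 - t) ^ alp * t ^ bet := by
  have h1 := intervalIntegral.integral_comp_mul_left (a := 0) (b := 1)
    (fun t => (s - t) ^ alp * t ^ bet) hs.ne'
  rw [mul_zero, mul_one, smul_eq_mul, inv_mul_eq_div, eq_div_iff hs.ne'] at h1
  have h2 : s ^ (alp + bet + 1) = s ^ alp * s ^ bet * s := by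
    rw [Real.rpow_add_one hs.ne', Real.rpow_add hs]
  rw [← h1, h2, mul_right_comm, ← intervalIntegral.integral_const_mul]
  congr 1
  refine intervalIntegral.integral_congr fun t ht => ?_
  rw [uIcc_of_le zero_le_one] at ht
  rw [show s - s * t = s * (1 - t) by ring, Real.mul_rpow hs.le (by linarith [ht.2]),
    Real.mul_rpow hs.le ht.1]
  ring

/-- The quadrature error is the weighted integral of the approximation error. -/
lemma Vop_sub_Vmop {alp bet : ℝ} (halp : -1 < alp) (hbet : -1 < bet) {k : ℝ → ℝ → ℝ}
    {f : ℝ → ℝ} {s : ℝ} (hs : s ∈ Icc (0 : ℝ) 1)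
    (hF : ContinuousOn (fun t => k t s * f t) (Icc 0 1)) (m l : ℕ) :
    Vop alp bet k f s - Vmop alp bet k m l f s =
      ∫ t in (0 : ℝ)..s, errLin m l (fun t => k t s * f t) t * ((s - t) ^ alp * t ^ bet) := by
  have hw := intervalIntegrable_sub_rpow_mul_rpow halp hbet hs.1
  have hsub : uIcc 0 s ⊆ Icc (0 : ℝ) 1 := by
    rw [uIcc_of_le hs.1]
    exact Icc_subset_Icc_right hs.2
  have hi : ∀ j ∈ Finset.range (m + 1), IntervalIntegrable (fun t =>
      k ((j : ℝ) / m) s * f ((j : ℝ) / m) * (gbBasis m l j t * ((s - t) ^ alp * t ^ bet)))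
      volume 0 s := fun j _ =>
    (hw.continuousOn_mul (continuous_gbBasis m l j).continuousOn).const_mul _
  have hV : Vmop alp bet k m l f s = ∫ t in (0 : ℝ)..s, ∑ j ∈ Finset.range (m + 1),
      k ((j : ℝ) / m) s * f ((j : ℝ) / m) * (gbBasis m l j t * ((s - t) ^ alp * t ^ bet)) := by
    rw [intervalIntegral.integral_finsetSum hi]
    refine Finset.sum_congr rfl fun j _ => ?_
    rw [intervalIntegral.integral_const_mul, Qcoef, mul_assoc, mul_comm]
    simp only [mul_assoc]
  have hVo : Vop alp bet k f s =
      ∫ t in (0 : ℝ)..s, k t s * f t * ((s - t) ^ alp * t ^ bet) := by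
    simp only [Vop, mul_assoc]
  rw [hV, hVo, ← intervalIntegral.integral_sub (hw.continuousOn_mul (hF.mono hsub))
    (by simpa only [Finset.sum_fn] using IntervalIntegrable.sum _ hi)]
  refine intervalIntegral.integral_congr fun t _ => ?_
  simp only [errLin_apply_eq, sub_mul, Finset.sum_mul]
  congr 1
  exact Finset.sum_congr rfl fun j _ => by ring

/-- Approximation of a product of two functions in `Z_λ`. -/
lemma exists_abs_errLin_mul_le {l : ℕ} (hl : 1 ≤ l) {lam : ℝ} (hlam : 0 < lam)
    (hlam2 : lam ≤ 2 * (l : ℝ)) : ∃ C : ℝ, 0 ≤ C ∧ ∀ f₁ f₂ : ℝ → ℝ, memZ lam (2 * l) f₁ →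
      memZ lam (2 * l) f₂ → ∀ m : ℕ, 1 ≤ m → ∀ x ∈ Icc (0 : ℝ) 1,
        |errLin m l (fun t => f₁ t * f₂ t) x| ≤
          C * Znorm lam (2 * l) f₁ * Znorm lam (2 * l) f₂ * (m : ℝ) ^ (-(lam / 2)) := by
  obtain ⟨C₀, hC₀, happ⟩ := exists_smooth_approx hlam hl
  obtain ⟨C₁, hC₁, hmul⟩ := exists_abs_iteratedDeriv_mul_fun_le l hl
  obtain ⟨C₂, hC₂, hmid⟩ := exists_abs_iteratedDeriv_le l hl
  obtain ⟨C₃, hC₃, herr⟩ := exists_abs_errLin_le_of_iteratedDeriv l hl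
  have hl0 : (0 : ℝ) < l := by positivity
  refine ⟨C₃ * C₂ * C₁ * (1 + C₀) ^ 2 + 2 ^ l * (C₀ + (1 + C₀) * C₀), by positivity,
    fun f₁ f₂ hf₁ hf₂ m hm => ?_⟩
  have hm1 : (1 : ℝ) ≤ m := by exact_mod_cast hm
  have hm0 : (0 : ℝ) < m := by positivity
  obtain ⟨g₁, hg₁, h₁⟩ := happ f₁ hf₁ m hm
  obtain ⟨g₂, hg₂, h₂⟩ := happ f₂ hf₂ m hm
  have hZ₁ := Znorm_nonneg hf₁
  have hZ₂ := Znorm_nonneg hf₂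
  have hb₁ := fun x (hx : x ∈ Icc (0 : ℝ) 1) => abs_le_Znorm hf₁ hx
  have hb₂ := fun x (hx : x ∈ Icc (0 : ℝ) 1) => abs_le_Znorm hf₂ hx
  set Z₁ := Znorm lam (2 * l) f₁
  set Z₂ := Znorm lam (2 * l) f₂
  set q : ℝ := (m : ℝ) ^ (-(lam / 2)) with hq
  have hq0 : 0 < q := Real.rpow_pos_of_pos hm0 _
  have hq1 : q ≤ 1 := Real.rpow_le_one_of_one_le_of_nonpos hm1 (by linarith)
  set ρ : ℝ := (m : ℝ) ^ (lam / (2 * l) - 1) with hρ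
  have hρm : ρ ∈ Ioc (0 : ℝ) 1 := by
    refine ⟨Real.rpow_pos_of_pos hm0 _, Real.rpow_le_one_of_one_le_of_nonpos hm1 ?_⟩
    rw [sub_nonpos, div_le_one (by positivity)]
    exact hlam2
  have hρl : ρ ^ l = (q * (m : ℝ) ^ l)⁻¹ := by
    rw [hρ, hq, ← Real.rpow_natCast _ l, ← Real.rpow_natCast _ l, ← Real.rpow_mul hm0.le,
      ← Real.rpow_add hm0, ← Real.rpow_neg hm0.le]
    congr 1
    field_simp
    ring
  have hρl1 : ρ ^ l ≤ 1 := pow_le_one₀ hρm.1.le hρm.2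
  have hqm : 1 ≤ q * (m : ℝ) ^ l := by
    rw [← inv_inv (q * (m : ℝ) ^ l), ← hρl]
    exact (one_le_inv₀ (pow_pos hρm.1 l)).mpr hρl1
  have hdiv : ∀ (A : ℝ) x, A / (ρ * wt m x) ^ l = A * (q * (m : ℝ) ^ l) / wt m x ^ l := by
    intro A x
    have := wt_pos hm x
    rw [mul_pow, hρl]
    field_simp
  have hg_bound : ∀ {f g : ℝ → ℝ} {Z : ℝ}, 0 ≤ Z → (∀ x ∈ Icc (0 : ℝ) 1, |f x| ≤ Z) →
      (∀ y ∈ Icc (0 : ℝ) 1, |f y - g y| ≤ C₀ * Z * q ∧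
        |iteratedDeriv (2 * l) g y| ≤ C₀ * Z * q / (wt m y / m) ^ l) →
      (∀ x ∈ Icc (0 : ℝ) 1, |g x| ≤ (1 + C₀) * Z) ∧
      ∀ x ∈ Icc (0 : ℝ) 1, |iteratedDeriv (2 * l) g x| ≤ (1 + C₀) * Z / (ρ * wt m x) ^ l := by
    intro f g Z hZ hf h
    refine ⟨fun x hx => ?_, fun x hx => (h x hx).2.trans ?_⟩
    · have e1 : C₀ * Z * q ≤ C₀ * Z := mul_le_of_le_one_right (by positivity) hq1
      have e2 := abs_le.mp ((h x hx).1.trans e1)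
      have e3 := abs_le.mp (hf x hx)
      exact abs_le.mpr ⟨by linarith, by linarith⟩
    · have hw := wt_pos hm x
      rw [hdiv, div_pow, div_div_eq_mul_div, mul_assoc (C₀ * Z)]
      gcongr
      linarith
  obtain ⟨hG₁, hD₁⟩ := hg_bound hZ₁ hb₁ h₁
  obtain ⟨hG₂, hD₂⟩ := hg_bound hZ₂ hb₂ h₂
  set P : ℝ := (1 + C₀) * Z₁ * ((1 + C₀) * Z₂) with hP
  have hP0 : 0 ≤ P := by positivity
  set M : ℝ := C₁ * P * (q * (m : ℝ) ^ l) with hM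
  have hPM : P ≤ M := by
    have h1 : P ≤ C₁ * P := le_mul_of_one_le_left hP0 hC₁
    exact h1.trans (le_mul_of_one_le_right (by positivity) hqm)
  have hM0 : 0 ≤ M := hP0.trans hPM
  set G : ℝ → ℝ := fun y => g₁ y * g₂ y with hG
  have hGc : ContDiff ℝ (2 * l : ℕ) G := hg₁.mul hg₂
  have hDG : ∀ x ∈ Icc (0 : ℝ) 1, |iteratedDeriv (2 * l) G x| ≤ M / wt m x ^ l := by
    intro x hx
    have := hmul m hm ρ hρm g₁ g₂ hg₁ hg₂ _ _ hG₁ hD₁ hG₂ hD₂ x hx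
    rwa [hdiv] at this
  have hGM : ∀ x ∈ Icc (0 : ℝ) 1, |G x| ≤ M := by
    intro x hx
    refine le_trans ?_ hPM
    rw [hG, abs_mul]
    exact mul_le_mul (hG₁ x hx) (hG₂ x hx) (abs_nonneg _) (by positivity)
  have hjs := hmid m hm G hGc M hM0 hGM hDG
  have hEG : ∀ x ∈ Icc (0 : ℝ) 1, |errLin m l G x| ≤ C₃ * (C₂ * M) * (1 / (m : ℝ)) ^ l := by
    refine herr m hm G hGc (C₂ * M) (by positivity) (fun j hj x hx => hjs j hj.le x hx)
      fun x hx => (hDG x hx).trans ?_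
    have hw := wt_pos hm x
    gcongr
    exact le_mul_of_one_le_left hM0 hC₂
  set R : ℝ := (C₀ + (1 + C₀) * C₀) * Z₁ * Z₂ * q with hR
  have hFG : ∀ x ∈ Icc (0 : ℝ) 1, |((fun t => f₁ t * f₂ t) - G) x| ≤ R := by
    intro x hx
    have e1 : ((fun t => f₁ t * f₂ t) - G) x = (f₁ x - g₁ x) * f₂ x + g₁ x * (f₂ x - g₂ x) := by
      simp only [hG, Pi.sub_apply]
      ring
    rw [e1]
    refine (abs_add_le _ _).trans ?_
    rw [abs_mul, abs_mul]
    have e2 := mul_le_mul (h₁ x hx).1 (hb₂ x hx) (abs_nonneg _) (by positivity)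
    have e3 := mul_le_mul (hG₁ x hx) (h₂ x hx).1 (abs_nonneg _) (by positivity)
    refine (add_le_add e2 e3).trans_eq ?_
    rw [hR]
    ring
  have hER := abs_errLin_le (m := m) (E := fun _ => R) (c := 1)
    (fun u _ => by rw [Bop_const, one_mul]) hFG l
  intro x hx
  have e1 : errLin m l (fun t => f₁ t * f₂ t) x =
      errLin m l ((fun t => f₁ t * f₂ t) - G) x + errLin m l G x := by
    rw [← Pi.add_apply, ← map_add, sub_add_cancel]
  rw [e1]
  refine (abs_add_le _ _).trans ((add_le_add (hER x hx) (hEG x hx)).trans_eq ?_)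
  rw [hR, hM, hP, one_div, inv_pow]
  field_simp
  ring

/-- pointwise error estimate for the discrete Volterra operator. -/
theorem volterra_quadrature_error_pointwise (l : ℕ) (hl : 1 ≤ l) (lam : ℝ) (hlam : 0 < lam)
    (hlam2 : lam ≤ 2 * (l : ℝ)) (alp bet : ℝ) (halp : -1 < alp) (hbet : -1 < bet)
    (hab : 0 ≤ alp + bet + 1) (k : ℝ → ℝ → ℝ)
    (hk : ContinuousOn (Function.uncurry k) (Set.Icc 0 1 ×ˢ Set.Icc 0 1))
    (hks : ∀ s ∈ Set.Icc (0 : ℝ) 1, memZ lam (2 * l) (fun t => k t s))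
    (hkb : BddAbove {y | ∃ s ∈ Set.Icc (0 : ℝ) 1, y = Znorm lam (2 * l) (fun t => k t s)}) :
    ∃ C > 0, ∀ f : ℝ → ℝ, memZ lam (2 * l) f → ∀ m : ℕ, 1 ≤ m →
      ∀ s ∈ Set.Icc (0 : ℝ) 1,
        |Vop alp bet k f s - Vmop alp bet k m l f s| ≤
          C * s ^ (alp + bet + 1) * Znorm lam (2 * l) (fun t => k t s) *
            Znorm lam (2 * l) f * ((m : ℝ) ^ (-(lam / 2)) + (m : ℝ) ^ (-(l : ℝ))) := by
  obtain ⟨C, hC, herr⟩ := exists_abs_errLin_mul_le hl hlam hlam2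
  set I : ℝ := ∫ t in (0 : ℝ)..1, (1 - t) ^ alp * t ^ bet with hI
  have hI0 : 0 ≤ I := intervalIntegral.integral_nonneg zero_le_one fun t ht =>
    mul_nonneg (Real.rpow_nonneg (by linarith [ht.2]) _) (Real.rpow_nonneg ht.1 _)
  refine ⟨C * I + 1, by positivity, fun f hf m hm s hs => ?_⟩
  have hZ := Znorm_nonneg hf
  have hZk := Znorm_nonneg (hks s hs)
  have hm0 : (0 : ℝ) < m := by exact_mod_cast hm
  have hs0 : 0 ≤ s ^ (alp + bet + 1) := Real.rpow_nonneg hs.1 _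
  set Z := Znorm lam (2 * l) f
  set Zk := Znorm lam (2 * l) (fun t => k t s)
  have hq := Real.rpow_nonneg hm0.le (-(lam / 2))
  have hql := Real.rpow_nonneg hm0.le (-(l : ℝ))
  set q := (m : ℝ) ^ (-(lam / 2))
  rw [Vop_sub_Vmop halp hbet hs ((hks s hs).1.mul hf.1) m l]
  rcases hs.1.eq_or_lt with rfl | hspos
  · rw [intervalIntegral.integral_same, abs_zero]
    positivity
  have hbound : |∫ t in (0 : ℝ)..s, errLin m l (fun t => k t s * f t) t *
      ((s - t) ^ alp * t ^ bet)| ≤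
      ∫ t in (0 : ℝ)..s, C * Zk * Z * q * ((s - t) ^ alp * t ^ bet) := by
    rw [← Real.norm_eq_abs]
    refine intervalIntegral.norm_integral_le_of_norm_le hs.1 (.of_forall fun t ht => ?_)
      ((intervalIntegrable_sub_rpow_mul_rpow halp hbet hs.1).const_mul _)
    have hw : 0 ≤ (s - t) ^ alp * t ^ bet :=
      mul_nonneg (Real.rpow_nonneg (by linarith [ht.2]) _) (Real.rpow_nonneg ht.1.le _)
    rw [norm_mul, Real.norm_eq_abs, Real.norm_of_nonneg hw]
    exact mul_le_mul_of_nonneg_right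
      (herr _ _ (hks s hs) hf m hm t ⟨ht.1.le, ht.2.trans hs.2⟩) hw
  refine hbound.trans ?_
  rw [intervalIntegral.integral_const_mul, integral_sub_rpow_mul_rpow alp bet hspos]
  calc C * Zk * Z * q * (s ^ (alp + bet + 1) * I)
      = C * I * s ^ (alp + bet + 1) * Zk * Z * q := by ring
    _ ≤ _ := by
      gcongr
      · linarith
      · linarith
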